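/- arXiv:math/9908074 — 3 statements merged into one kernel-verified Lean document; each statement's English description precedes it below -/
import Mathlib

section
/- Let M be a normal countably compact space whose Stone–Čech remainder βM \ M is homeomorphic to the disjoint sum of a metrizable compactum C and an open subset U of S³, and assume every compact subset of M has covering dimension ≤ 4. If L is a simplicial complex with [S⁴] ≤ [L] and e-dim C = [L], then e-dim M = [L]. -/
open Set Topology

universe u v w

/-- An abstract simplicial complex on a vertex set `V`. -/
structure SimpComplex (V : Type v) where
  faces : Set (Finset V)
  down_closed : ∀ s ∈ faces, ∀ t, t ⊆ s → t.Nonempty → t ∈ faces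

/-- The geometric realization of a simplicial complex with the metric (ℓ¹) topology,
realized inside the Banach space `ℓ¹(V)`. -/
def SimpComplex.space {V : Type v} (K : SimpComplex V) : Set (lp (fun _ : V => ℝ) 1) :=
  {f | ∃ s ∈ K.faces, (∀ v : V, (f : ∀ _ : V, ℝ) v ≠ 0 → v ∈ s) ∧
    (∀ v : V, 0 ≤ (f : ∀ _ : V, ℝ) v) ∧ ∑ v ∈ s, (f : ∀ _ : V, ℝ) v = 1}

/-- `Z` is an absolute extensor of `X`: every continuous map from a closed subset of `X`
into `Z` extends continuously over all of `X`. -/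
def IsAE (Z X : Type*) [TopologicalSpace Z] [TopologicalSpace X] : Prop :=
  ∀ Y : Set X, IsClosed Y → ∀ f : C(Y, Z), ∃ g : C(X, Z), ∀ y : Y, g y = f y

/-- `Z` is an absolute neighborhood extensor of `X`. -/
def IsANE (Z X : Type*) [TopologicalSpace Z] [TopologicalSpace X] : Prop :=
  ∀ Y : Set X, IsClosed Y → ∀ f : C(Y, Z),
    ∃ U : Set X, IsOpen U ∧ Y ⊆ U ∧ ∃ g : C(U, Z),
      ∀ (y : Y) (h : (y : X) ∈ U), g ⟨y, h⟩ = f y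

/-- A space is countably compact if every countable open cover has a finite subcover. -/
def CountablyCompact (X : Type*) [TopologicalSpace X] : Prop :=
  ∀ 𝒰 : ℕ → Set X, (∀ n, IsOpen (𝒰 n)) → (⋃ n, 𝒰 n) = univ →
    ∃ t : Finset ℕ, (⋃ n ∈ t, 𝒰 n) = univ

/-- A set is functionally open if it is the cozero set of a real-valued continuous function. -/
def FunctionallyOpen {X : Type*} [TopologicalSpace X] (U : Set X) : Prop :=
  ∃ φ : C(X, ℝ), U = φ ⁻¹' ({0}ᶜ)

/-- `CovDimLE X n` : every finite functionally open cover of `X` has a finite functionally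
open refinement of order at most `n + 1` (any `n + 2` distinct members meet emptily). -/
def CovDimLE (X : Type*) [TopologicalSpace X] (n : ℕ) : Prop :=
  ∀ 𝒰 : Finset (Set X), (∀ U ∈ 𝒰, FunctionallyOpen U) → ⋃₀ (𝒰 : Set (Set X)) = univ →
    ∃ 𝒱 : Finset (Set X), (∀ V ∈ 𝒱, FunctionallyOpen V) ∧ ⋃₀ (𝒱 : Set (Set X)) = univ ∧
      (∀ V ∈ 𝒱, ∃ U ∈ 𝒰, V ⊆ U) ∧
      ∀ 𝒲 : Finset (Set X), 𝒲 ⊆ 𝒱 → n + 1 < 𝒲.card → ⋂₀ (𝒲 : Set (Set X)) = ∅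

/-- The covering dimension of `X` as an extended natural number (`⊤` if no finite bound). -/
noncomputable def covDim (X : Type*) [TopologicalSpace X] : ℕ∞ :=
  sInf ((↑) '' {n : ℕ | CovDimLE X n})

/-- The Stone–Čech remainder `βX \ X`. -/
def StoneCechRemainder (X : Type*) [TopologicalSpace X] : Set (StoneCech X) :=
  (range (stoneCechUnit : X → StoneCech X))ᶜ

/-- Extension-type preorder: `extLE K L` iff for every normal countably compact space `X`,
`K ∈ AE(X)` implies `L ∈ AE(X)` (i.e. `[K] ≤ [L]`). -/
def extLE {V : Type v} {W : Type w} (K : SimpComplex V) (L : SimpComplex W) : Prop :=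
  ∀ (X : Type u) (_ : TopologicalSpace X) (_ : NormalSpace X), CountablyCompact X →
    IsAE ↥K.space X → IsAE ↥L.space X

/-- `e-dim X = [L]` : `L ∈ AE(X)` and `[L]` is the smallest extension type of a complex
that is an absolute extensor of `X`. -/
def eDimEq (X : Type u) [TopologicalSpace X] {W : Type w} (L : SimpComplex W) : Prop :=
  IsAE ↥L.space X ∧
    ∀ (V : Type u) (K : SimpComplex V), IsAE ↥K.space X → extLE.{u} L K

/-- The boundary complex of the `(n+1)`-simplex; its realization is the `n`-sphere. -/
def sphereComplex (n : ℕ) : SimpComplex (Fin (n + 2)) where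
  faces := {s | s.Nonempty ∧ s ≠ Finset.univ}
  down_closed := by
    rintro s ⟨-, hs⟩ t hts ht
    exact ⟨ht, fun h => hs (Finset.univ_subset_iff.mp (h ▸ hts))⟩


/-- image of a countably compact space in a metric space is compact -/
theorem CountablyCompact.isCompact_range {X E : Type*} [TopologicalSpace X] [MetricSpace E]
    (hX : CountablyCompact X) {f : X → E} (hf : Continuous f) : IsCompact (range f) := by
  apply IsSeqCompact.isCompact
  intro x hx
  choose y hy using hx
  by_contra hcon
  have key : ∀ p : X, ∃ n : ℕ, p ∉ closure (y '' {m | n ≤ m}) := by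
    intro p
    by_contra! hp
    apply hcon
    have : MapClusterPt (f p) Filter.atTop x := by
      rw [mapClusterPt_iff_frequently]
      intro s hs
      rw [Filter.frequently_atTop]
      intro n
      have h1 := hp n
      rw [mem_closure_iff_nhds] at h1
      obtain ⟨z, hz1, m, hm, rfl⟩ := h1 _ (hf.continuousAt.preimage_mem_nhds hs)
      exact ⟨m, hm, by rw [← hy m]; exact hz1⟩
    obtain ⟨φ, h1, h2⟩ := MapClusterPt.tendsto_subseq this
    exact ⟨f p, mem_range_self _, φ, h1, h2⟩
  obtain ⟨t, ht⟩ := hX (fun n => (closure (y '' {m | n ≤ m}))ᶜ)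
    (fun n => isClosed_closure.isOpen_compl) (by
      ext p; simpa using key p)
  have h1 : y (t.sup id) ∈ (univ : Set X) := mem_univ _
  rw [← ht] at h1
  simp only [mem_iUnion] at h1
  obtain ⟨n, hn, h2⟩ := h1
  exact h2 (subset_closure ⟨_, Finset.le_sup (f := id) hn, rfl⟩)

theorem countablyCompact_of_compact (X : Type*) [TopologicalSpace X] [CompactSpace X] :
    CountablyCompact X := by
  intro 𝒰 ho hc
  obtain ⟨t, ht⟩ := isCompact_univ.elim_finite_subcover 𝒰 ho hc.ge
  exact ⟨t, univ_subset_iff.mp ht⟩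

/-- radial clipping -/
theorem clip_aux {E : Type*} [NormedAddCommGroup E] [NormedSpace ℝ E] (r : ℝ) (hr : 0 ≤ r) :
    ∃ c : E → E, Continuous c ∧ (∀ x, ‖c x‖ ≤ r) ∧ (∀ x, ‖x‖ ≤ r → c x = x) ∧
      ∀ S : Submodule ℝ E, ∀ x ∈ S, c x ∈ S := by
  rcases hr.eq_or_lt with rfl | hr
  · exact ⟨fun _ => 0, continuous_const, by simp, fun x hx => (norm_le_zero_iff.mp hx).symm,
      fun S _ _ => S.zero_mem⟩
  have hpos : ∀ x : E, 0 < max r ‖x‖ := fun x => lt_max_of_lt_left hr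
  refine ⟨fun x => (r / max r ‖x‖) • x, ?_, ?_, ?_, fun S x hx => S.smul_mem _ hx⟩
  · exact (continuous_const.div (continuous_const.max continuous_norm)
      (fun x => (hpos x).ne')).smul continuous_id
  · intro x
    rw [norm_smul, norm_div, Real.norm_of_nonneg hr.le, Real.norm_of_nonneg (hpos x).le,
      div_mul_eq_mul_div, div_le_iff₀ (hpos x)]
    exact mul_le_mul_of_nonneg_left (le_max_right _ _) hr.le
  · intro x hx
    simp [max_eq_left hx, hr.ne']

/-- Schauder projection -/
theorem schauder_aux {E : Type*} [NormedAddCommGroup E] [NormedSpace ℝ E] {A : Set E}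
    (hA : IsCompact A) {ε : ℝ} (hε : 0 < ε) :
    ∃ (S : Submodule ℝ E) (P : E → E), FiniteDimensional ℝ S ∧ ContinuousOn P A ∧
      (∀ a ∈ A, P a ∈ S) ∧ ∀ a ∈ A, ‖P a - a‖ ≤ ε := by
  obtain ⟨t, -, htf, htc⟩ := hA.finite_cover_balls hε
  lift t to Finset E using htf
  let ρ : E → E → ℝ := fun i a => max 0 (ε - dist a i)
  have hρ : ∀ i, Continuous (ρ i) := fun i => by fun_prop
  have hρ0 : ∀ i a, 0 ≤ ρ i a := fun i a => le_max_left _ _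
  have hsum : ∀ a ∈ A, 0 < ∑ i ∈ t, ρ i a := by
    intro a ha
    obtain ⟨i, hi, hai⟩ := mem_iUnion₂.mp (htc ha)
    refine Finset.sum_pos' (fun i _ => hρ0 i a) ⟨i, hi, ?_⟩
    exact lt_max_of_lt_right (sub_pos.mpr hai)
  refine ⟨Submodule.span ℝ (t : Set E), fun a => (∑ i ∈ t, ρ i a)⁻¹ • ∑ i ∈ t, ρ i a • i,
    FiniteDimensional.span_finset ℝ t, ?_, ?_, ?_⟩
  · refine ContinuousOn.smul (ContinuousOn.inv₀ ?_ fun a ha => (hsum a ha).ne') ?_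
    · fun_prop
    · fun_prop
  · intro a ha
    exact Submodule.smul_mem _ _ (Submodule.sum_mem _ fun i hi =>
      Submodule.smul_mem _ _ (Submodule.subset_span hi))
  · intro a ha
    have h0 := hsum a ha
    have : (∑ i ∈ t, ρ i a)⁻¹ • ∑ i ∈ t, ρ i a • i - a =
        (∑ i ∈ t, ρ i a)⁻¹ • ∑ i ∈ t, ρ i a • (i - a) := by
      simp only [smul_sub, Finset.sum_sub_distrib]
      congr 1
      rw [← Finset.sum_smul, smul_smul, inv_mul_cancel₀ h0.ne', one_smul]
    rw [this, norm_smul, norm_inv, Real.norm_of_nonneg h0.le, inv_mul_le_iff₀ h0, Finset.sum_mul]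
    refine (norm_sum_le _ _).trans (Finset.sum_le_sum fun i _ => ?_)
    rw [norm_smul, Real.norm_of_nonneg (hρ0 i a)]
    by_cases h : dist a i ≤ ε
    · rw [dist_comm, dist_eq_norm] at h
      exact mul_le_mul_of_nonneg_left h (hρ0 i a)
    · have : ρ i a = 0 := max_eq_left (by linarith)
      simp [this]

open BoundedContinuousFunction in
/-- Tietze extension theorem for Banach spaces and maps with relatively compact image. -/
theorem tietze_banach {X E : Type*} [TopologicalSpace X] [NormalSpace X]
    [NormedAddCommGroup E] [NormedSpace ℝ E] [CompleteSpace E] {B : Set X} (hB : IsClosed B)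
    {A : Set E} (hA : IsCompact A) {f : X → E} (hf : ContinuousOn f B) (hfA : MapsTo f B A) :
    ∃ F : X → E, Continuous F ∧ EqOn F f B := by
  let R : NormedAddGroupHom (X →ᵇ E) (B →ᵇ E) :=
    { toFun := fun g => g.compContinuous ⟨Subtype.val, continuous_subtype_val⟩
      map_add' := fun _ _ => rfl
      bound' := ⟨1, fun g => by
        rw [one_mul]
        exact (norm_le (norm_nonneg _)).mpr fun x => g.norm_coe_le_norm _⟩ }
  have hR : ∀ g (b : B), R g b = g b := fun _ _ => rfl
  let K : AddSubgroup (B →ᵇ E) :=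
    { carrier := {g | ∃ S : Submodule ℝ E, FiniteDimensional ℝ S ∧ ∀ b, g b ∈ S}
      zero_mem' := ⟨⊥, inferInstance, fun b => by simp⟩
      add_mem' := by
        rintro g h ⟨S, hS, hg⟩ ⟨T, hT, hh⟩
        exact ⟨S ⊔ T, inferInstance, fun b => add_mem (Submodule.mem_sup_left (hg b))
          (Submodule.mem_sup_right (hh b))⟩
      neg_mem' := by
        rintro g ⟨S, hS, hg⟩
        exact ⟨S, hS, fun b => neg_mem (hg b)⟩ }
  have hyp : R.SurjectiveOnWith K 1 := by
    rintro g ⟨S, hS, hg⟩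
    obtain ⟨G, hG⟩ := ContinuousMap.exists_restrict_eq (Y := S) hB
      ⟨fun b => (⟨g b, hg b⟩ : S), by fun_prop⟩
    obtain ⟨c, hc1, hc2, hc3, -⟩ := clip_aux (E := E) ‖g‖ (norm_nonneg _)
    refine ⟨BoundedContinuousFunction.ofNormedAddCommGroup (fun x => c (G x)) (by fun_prop) ‖g‖
      (fun x => hc2 _), ?_, ?_⟩
    · ext b
      rw [hR]
      have : G b = (⟨g b, hg b⟩ : S) := DFunLike.congr_fun hG b
      simp [this, hc3 _ (g.norm_coe_le_norm b)]
    · rw [one_mul]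
      exact norm_ofNormedAddCommGroup_le _ (norm_nonneg _) _
  have h2 := controlled_closure_of_complete one_pos one_pos hyp
  obtain ⟨C, hC⟩ := hA.isBounded.exists_norm_le
  let f' : B →ᵇ E := BoundedContinuousFunction.ofNormedAddCommGroup (fun b : B => f b)
    (continuousOn_iff_continuous_domRestrict.mp hf) C (fun b => hC _ (hfA b.2))
  have hmem : f' ∈ K.topologicalClosure := by
    change f' ∈ closure (K : Set (B →ᵇ E))
    rw [Metric.mem_closure_iff]
    intro ε hε
    obtain ⟨S, P, hS, hP, hPS, hPa⟩ := schauder_aux hA (half_pos hε)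
    refine ⟨BoundedContinuousFunction.ofNormedAddCommGroup (fun b : B => P (f b))
      (continuousOn_iff_continuous_domRestrict.mp (hP.comp hf hfA)) (C + ε / 2) (fun b => ?_), ?_, ?_⟩
    · have h1 := hPa _ (hfA b.2)
      have h2 := hC _ (hfA b.2)
      have : P (f b) = (P (f b) - f b) + f b := by abel
      rw [this]
      refine (norm_add_le _ _).trans (by linarith)
    · exact ⟨S, hS, fun b => hPS _ (hfA b.2)⟩
    · refine lt_of_le_of_lt ((dist_le (half_pos hε).le).mpr fun b => ?_) (half_lt_self hε)
      rw [dist_comm, dist_eq_norm]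
      exact hPa _ (hfA b.2)
  obtain ⟨g, hg, -⟩ := h2 f' hmem
  refine ⟨g, g.continuous, fun b hb => ?_⟩
  have := DFunLike.congr_fun hg ⟨b, hb⟩
  exact this


section nbhd
variable {V : Type v}


theorem l1_hasSum (x : (lp (fun _ : V => ℝ) 1)) : HasSum (fun v => |x v|) ‖x‖ := by
  have := lp.hasSum_norm (p := 1) (by simp) x
  simpa using this

theorem l1_summable (x : (lp (fun _ : V => ℝ) 1)) : Summable (fun v => |x v|) := (l1_hasSum x).summable

theorem l1_norm (x : (lp (fun _ : V => ℝ) 1)) : ‖x‖ = ∑' v, |x v| := (l1_hasSum x).tsum_eq.symm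

theorem l1_coord (x : (lp (fun _ : V => ℝ) 1)) (v : V) : |x v| ≤ ‖x‖ :=
  le_hasSum (l1_hasSum x) v fun _ _ => abs_nonneg _

theorem l1_memlp {f : V → ℝ} (hf : Summable fun v => |f v|) : Memℓp f 1 := by
  apply memℓp_gen
  simpa using hf

/-- soft thresholding -/
noncomputable def softT (x : (lp (fun _ : V => ℝ) 1)) (a : ℝ) : (lp (fun _ : V => ℝ) 1) :=
  ⟨fun v => max 0 (x v - max 0 a), l1_memlp (Summable.of_nonneg_of_le (fun _ => abs_nonneg _)
    (fun v => by
      rw [abs_of_nonneg (le_max_left _ _)]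
      refine max_le (abs_nonneg _) ?_
      have := le_abs_self (x v)
      have := le_max_left 0 a
      linarith) (l1_summable x))⟩

theorem softT_apply (x : (lp (fun _ : V => ℝ) 1)) (a : ℝ) (v : V) : softT x a v = max 0 (x v - max 0 a) := rfl

theorem softT_nonneg (x : (lp (fun _ : V => ℝ) 1)) (a : ℝ) (v : V) : 0 ≤ softT x a v := le_max_left _ _

theorem softT_lip (x y : (lp (fun _ : V => ℝ) 1)) (a : ℝ) : ‖softT x a - softT y a‖ ≤ ‖x - y‖ := by
  rw [l1_norm, l1_norm]
  refine (l1_summable _).tsum_le_tsum (fun v => ?_) (l1_summable _)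
  simp only [lp.coeFn_sub, Pi.sub_apply, softT_apply]
  refine (abs_max_sub_max_le_max _ _ _ _).trans ?_
  simp

theorem softT_cont (x : (lp (fun _ : V => ℝ) 1)) : Continuous (softT x) := by
  rw [continuous_iff_continuousAt]
  intro a
  unfold ContinuousAt
  rw [tendsto_iff_norm_sub_tendsto_zero]
  simp only [l1_norm]
  have h0 : (0 : ℝ) = ∑' v : V, (0 : ℝ) := by simp
  rw [h0]
  refine tendsto_tsum_of_dominated_convergence (bound := fun v => |x v|) (l1_summable x) ?_ ?_
  · intro v
    have : Continuous fun b : ℝ => |softT x b v - softT x a v| := by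
      simp only [softT_apply]; fun_prop
    have := this.tendsto a
    simpa using this
  · refine Filter.Eventually.of_forall fun b v => ?_
    simp only [lp.coeFn_sub, Pi.sub_apply, softT_apply, Real.norm_eq_abs, abs_abs]
    have h1 : ∀ c : ℝ, max 0 (x v - max 0 c) ≤ |x v| := fun c => by
      refine max_le (abs_nonneg _) ?_
      have := le_abs_self (x v)
      have := le_max_left 0 c
      linarith
    have h2 : ∀ c : ℝ, 0 ≤ max 0 (x v - max 0 c) := fun c => le_max_left _ _
    rw [abs_le]
    constructor <;> linarith [h1 a, h1 b, h2 a, h2 b]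

theorem softT_cont2 : Continuous fun p : (lp (fun _ : V => ℝ) 1) × ℝ => softT p.1 p.2 := by
  rw [continuous_iff_continuousAt]
  rintro ⟨x, a⟩
  unfold ContinuousAt
  rw [tendsto_iff_norm_sub_tendsto_zero]
  have h1 : Filter.Tendsto (fun p : (lp (fun _ : V => ℝ) 1) × ℝ => ‖p.1 - x‖ + ‖softT x p.2 - softT x a‖)
      (𝓝 (x, a)) (𝓝 0) := by
    have : Continuous (fun p : (lp (fun _ : V => ℝ) 1) × ℝ => ‖p.1 - x‖ + ‖softT x p.2 - softT x a‖) := by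
      have := (softT_cont x).comp (continuous_snd (X := (lp (fun _ : V => ℝ) 1)))
      simp only [Function.comp_def] at this
      fun_prop
    have := this.tendsto (x, a)
    simpa using this
  refine squeeze_zero (fun _ => norm_nonneg _) (fun p => ?_) h1
  have := softT_lip p.1 x p.2
  calc ‖softT p.1 p.2 - softT x a‖
      = ‖(softT p.1 p.2 - softT x p.2) + (softT x p.2 - softT x a)‖ := by congr 1; abel
    _ ≤ _ := (norm_add_le _ _).trans (by linarith)

/-- A compact subset of a metric complex is a retract, in the complex, of a neighborhood. -/
theorem SimpComplex.nbhd_retract (K : SimpComplex V) {A : Set (lp (fun _ : V => ℝ) 1)} (hA : IsCompact A)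
    (hAK : A ⊆ K.space) :
    ∃ (O : Set (lp (fun _ : V => ℝ) 1)) (r : (lp (fun _ : V => ℝ) 1) → (lp (fun _ : V => ℝ) 1)), IsOpen O ∧ A ⊆ O ∧ ContinuousOn r O ∧ MapsTo r O K.space ∧
      ∀ a ∈ A, r a = a := by
  rcases A.eq_empty_or_nonempty with rfl | hne
  · exact ⟨∅, id, isOpen_empty, le_rfl, continuousOn_empty _, mapsTo_empty _ _, by simp⟩
  let Φ : (lp (fun _ : V => ℝ) 1) → (lp (fun _ : V => ℝ) 1) := fun q => softT q (Metric.infDist q A)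
  have hΦ : Continuous Φ :=
    softT_cont2.comp (continuous_id.prodMk (Metric.continuous_infDist_pt A))
  have hΦA : ∀ a ∈ A, Φ a = a ∧ ‖a‖ = 1 := by
    intro a ha
    obtain ⟨s, hs, h1, h2, h3⟩ := hAK ha
    constructor
    · ext v
      simp only [Φ, softT_apply, Metric.infDist_zero_of_mem ha]
      simpa using h2 v
    · rw [l1_norm, tsum_eq_sum (s := s)]
      · rw [← h3]
        exact Finset.sum_congr rfl fun v _ => abs_of_nonneg (h2 v)
      · intro v hv
        by_contra h
        exact hv (h1 v (by simpa using h))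
  refine ⟨{q | Φ q ≠ 0}, fun q => ‖Φ q‖⁻¹ • Φ q, isOpen_ne_fun hΦ continuous_const, ?_, ?_, ?_, ?_⟩
  · intro a ha
    obtain ⟨h1, h2⟩ := hΦA a ha
    simp only [mem_ofPred_eq, h1]
    rintro rfl
    simp at h2
  · refine ContinuousOn.smul (ContinuousOn.inv₀ hΦ.norm.continuousOn ?_) hΦ.continuousOn
    intro q hq
    exact norm_ne_zero_iff.mpr hq
  · intro q hq
    obtain ⟨p, hp, hpd⟩ := hA.exists_infDist_eq_dist hne q
    obtain ⟨s, hs, h1, h2, h3⟩ := hAK hp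
    have hsupp : ∀ v, Φ q v ≠ 0 → v ∈ s := by
      intro v hv
      apply h1
      intro h0
      apply hv
      simp only [Φ, softT_apply]
      apply max_eq_left
      have h4 := l1_coord (q - p) v
      rw [← dist_eq_norm, ← hpd] at h4
      simp only [lp.coeFn_sub, Pi.sub_apply, h0, sub_zero] at h4
      have h5 := le_abs_self (q v)
      have h6 := le_max_right 0 (Metric.infDist q A)
      linarith
    have hnorm : ‖Φ q‖ = ∑ v ∈ s, Φ q v := by
      rw [l1_norm, tsum_eq_sum (s := s)]
      · exact Finset.sum_congr rfl fun v _ => abs_of_nonneg (softT_nonneg _ _ v)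
      · intro v hv
        by_contra h
        exact hv (hsupp v (by simpa using h))
    have hpos : 0 < ‖Φ q‖ := norm_pos_iff.mpr hq
    refine ⟨s, hs, ?_, ?_, ?_⟩
    · intro v hv
      apply hsupp
      intro h
      apply hv
      simp [h]
    · intro v
      simp only [lp.coeFn_smul, Pi.smul_apply, smul_eq_mul]
      exact mul_nonneg (inv_nonneg.mpr hpos.le) (softT_nonneg _ _ v)
    · simp only [lp.coeFn_smul, Pi.smul_apply, smul_eq_mul]
      rw [← Finset.mul_sum, ← hnorm, inv_mul_cancel₀ hpos.ne']
  · intro a ha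
    obtain ⟨h1, h2⟩ := hΦA a ha
    simp only [h1, h2, inv_one, one_smul]

theorem SimpComplex.ane (K : SimpComplex V) {X : Type*} [TopologicalSpace X] [CompactSpace X]
    [T2Space X] {B : Set X} (hB : IsClosed B) {f : X → (lp (fun _ : V => ℝ) 1)} (hf : ContinuousOn f B)
    (hfK : MapsTo f B K.space) :
    ∃ (G : Set X) (g : X → (lp (fun _ : V => ℝ) 1)), IsOpen G ∧ B ⊆ G ∧ ContinuousOn g G ∧ MapsTo g G K.space ∧
      EqOn g f B := by
  have hA : IsCompact (f '' B) := hB.isCompact.image_of_continuousOn hf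
  obtain ⟨F, hF, hFf⟩ := tietze_banach hB hA hf (mapsTo_image f B)
  obtain ⟨O, r, hO, hAO, hr, hrK, hrA⟩ := K.nbhd_retract hA (by
    rintro _ ⟨b, hb, rfl⟩; exact hfK hb)
  refine ⟨F ⁻¹' O, r ∘ F, hO.preimage hF, ?_, hr.comp hF.continuousOn (mapsTo_preimage _ _),
    fun x hx => hrK hx, ?_⟩
  · intro b hb
    change F b ∈ O
    rw [hFf hb]; exact hAO (mem_image_of_mem _ hb)
  · intro b hb
    simp only [Function.comp, hFf hb]
    exact hrA _ (mem_image_of_mem _ hb)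

end nbhd

/-- Extension property for closed subsets, in terms of total functions. -/
def AES {E X : Type*} [TopologicalSpace E] [TopologicalSpace X] (K : Set E) (A : Set X) : Prop :=
  ∀ B ⊆ A, IsClosed B → ∀ f : X → E, ContinuousOn f B → MapsTo f B K →
    ∃ g : X → E, ContinuousOn g A ∧ MapsTo g A K ∧ EqOn g f B

theorem aes_of_isAE {E X T : Type*} [TopologicalSpace E] [Zero E] [TopologicalSpace X]
    [TopologicalSpace T] {K : Set E} {e : T → X} (he : IsClosedEmbedding e)
    (h : IsAE ↥K T) : AES K (range e) := by
  intro B hBA hB f hf hfK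
  obtain ⟨g, hg⟩ := h (e ⁻¹' B) (hB.preimage he.continuous)
    ⟨fun y => ⟨f (e y), hfK y.2⟩, Continuous.subtype_mk
      (hf.comp_continuous (he.continuous.comp continuous_subtype_val) fun y => y.2) _⟩
  refine ⟨Function.extend e (fun t => (g t : E)) 0, ?_, ?_, ?_⟩
  · rw [← image_univ]
    rw [he.isInducing.continuousOn_image_iff, continuousOn_univ]
    have : Function.extend e (fun t => (g t : E)) 0 ∘ e = fun t => (g t : E) := by
      ext t; exact he.injective.extend_apply _ _ _
    rw [this]
    fun_prop
  · rintro _ ⟨t, rfl⟩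
    rw [he.injective.extend_apply]; exact (g t).2
  · intro b hb
    obtain ⟨t, rfl⟩ := hBA hb
    rw [he.injective.extend_apply]
    have := hg ⟨t, hb⟩
    exact congrArg Subtype.val this

theorem isAE_of_aes {E X T : Type*} [TopologicalSpace E] [Zero E] [TopologicalSpace X]
    [TopologicalSpace T] {K : Set E} {e : T → X} (he : IsClosedEmbedding e)
    (h : AES K (range e)) : IsAE ↥K T := by
  intro Y hY f
  have hinj : Function.Injective (fun y : Y => e y) :=
    he.injective.comp Subtype.val_injective
  have hind : IsInducing (fun y : Y => e y) := he.isInducing.comp IsInducing.subtypeVal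
  have hr : e '' Y = (fun y : Y => e y) '' univ := by
    ext x; simp
  obtain ⟨g, hg, hgK, hgf⟩ := h (e '' Y) (image_subset_range _ _) (he.isClosedMap _ hY)
    (Function.extend (fun y : Y => e y) (fun y => (f y : E)) 0) (by
      rw [hr, hind.continuousOn_image_iff, continuousOn_univ]
      have : Function.extend (fun y : Y => e y) (fun y => (f y : E)) 0 ∘ (fun y : Y => e y) =
          fun t => (f t : E) := by
        ext t; exact hinj.extend_apply _ _ _
      rw [this]
      fun_prop) (by
      rw [hr]
      rintro _ ⟨y, -, rfl⟩
      rw [hinj.extend_apply]; exact (f y).2)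
  refine ⟨⟨fun t => ⟨g (e t), hgK (mem_range_self t)⟩, Continuous.subtype_mk
    (hg.comp_continuous he.continuous mem_range_self) _⟩, fun y => Subtype.ext ?_⟩
  have := hgf (mem_image_of_mem e y.2)
  simp only [ContinuousMap.coe_mk, this]
  exact hinj.extend_apply _ _ y

theorem AES.mono {E X : Type*} [TopologicalSpace E] [TopologicalSpace X] {K : Set E}
    {A A' : Set X} (h : AES K A) (hA : A' ⊆ A) : AES K A' := by
  intro B hBA hB f hf hfK
  obtain ⟨g, h1, h2, h3⟩ := h B (hBA.trans hA) hB f hf hfK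
  exact ⟨g, h1.mono hA, h2.mono_left hA, h3⟩

open Classical in
theorem glue_aux {E X : Type*} [TopologicalSpace E] [TopologicalSpace X] {K : Set E}
    {A B : Set X} (hA : IsClosed A) (hB : IsClosed B) {f g : X → E} (hf : ContinuousOn f A)
    (hg : ContinuousOn g B) (hfg : EqOn f g (A ∩ B)) (hfK : MapsTo f A K) (hgK : MapsTo g B K) :
    ∃ h : X → E, ContinuousOn h (A ∪ B) ∧ MapsTo h (A ∪ B) K ∧ EqOn h f A ∧ EqOn h g B := by
  have h1 : EqOn (A.piecewise f g) f A := A.piecewise_eqOn f g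
  have h2 : EqOn (A.piecewise f g) g B := by
    intro x hx
    by_cases hxA : x ∈ A
    · rw [h1 hxA]; exact hfg ⟨hxA, hx⟩
    · exact piecewise_eq_of_notMem _ _ _ hxA
  refine ⟨A.piecewise f g, (hf.congr h1).union_of_isClosed (hg.congr h2) hA hB, ?_, h1, h2⟩
  rintro x (hx | hx)
  · rw [h1 hx]; exact hfK hx
  · rw [h2 hx]; exact hgK hx

/-- Proposition 2.12 for closed subsets of compact spaces. -/
theorem aes_union {V : Type v} (K : SimpComplex V) {X : Type*} [TopologicalSpace X]
    [CompactSpace X] [T2Space X] {A F : Set X} (hA : IsClosed A) (hF : IsClosed F) (_ : F ⊆ A)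
    (h1 : AES K.space F) (h2 : ∀ Y ⊆ A \ F, IsClosed Y → AES K.space Y) : AES K.space A := by
  intro B hBA hB f hf hfK
  obtain ⟨g, hg, hgK, hgf⟩ := h1 (B ∩ F) inter_subset_right (hB.inter hF) f
    (hf.mono inter_subset_left) (hfK.mono_left inter_subset_left)
  obtain ⟨h, hh, hhK, hhf, -⟩ := glue_aux hB hF hf hg hgf.symm hfK hgK
  obtain ⟨G, k, hG, hBG, hk, hkK, hkh⟩ := K.ane (hB.union hF) hh hhK
  obtain ⟨N, hN, hBN, hNG⟩ := normal_exists_closure_subset (hB.union hF) hG hBG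
  have hYc : IsClosed (A \ N) := hA.sdiff hN
  obtain ⟨l, hl, hlK, hlk⟩ := h2 (A \ N)
    (fun x hx => ⟨hx.1, fun hxF => hx.2 (hBN (Or.inr hxF))⟩) hYc (A \ N ∩ closure N)
    inter_subset_left (hYc.inter isClosed_closure) k
    (hk.mono (inter_subset_right.trans hNG)) (hkK.mono_left (inter_subset_right.trans hNG))
  obtain ⟨m, hm, hmK, hml, hmk⟩ := glue_aux hYc isClosed_closure hl (hk.mono hNG) hlk hlK
    (hkK.mono_left hNG)
  have hsub : A ⊆ A \ N ∪ closure N := by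
    intro x hx
    by_cases hxN : x ∈ N
    · exact Or.inr (subset_closure hxN)
    · exact Or.inl ⟨hx, hxN⟩
  refine ⟨m, hm.mono hsub, hmK.mono_left hsub, fun b hb => ?_⟩
  rw [hmk (subset_closure (hBN (Or.inl hb))), hkh (Or.inl hb), hhf hb]


/-- every map to `E` can be approximated by maps whose range has dense complement -/
def Thin (X E : Type*) [TopologicalSpace X] [NormedAddCommGroup E] : Prop :=
  ∀ F : C(X, E), ∀ ε > 0, ∃ G : C(X, E), (∀ x, ‖G x - F x‖ < ε) ∧ Dense (range G)ᶜ

theorem thin_of_covDimLE {X E : Type*} [TopologicalSpace X] [CompactSpace X]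
    [NormedAddCommGroup E] [NormedSpace ℝ E] [FiniteDimensional ℝ E] {n : ℕ}
    (hE : Module.finrank ℝ E = n + 1) (hX : CovDimLE X n) : Thin X E := by
  classical
  intro F ε hε
  obtain ⟨t, -, htf, htc⟩ := (isCompact_range F.continuous).finite_cover_balls hε
  lift t to Finset E using htf
  obtain ⟨𝒱, h1, h2, h3, h4⟩ := hX (t.image fun e => F ⁻¹' Metric.ball e ε) (by
      intro U hU
      obtain ⟨e, he, rfl⟩ := Finset.mem_image.mp hU
      refine ⟨⟨fun x => max 0 (ε - dist (F x) e), by fun_prop⟩, ?_⟩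
      ext x
      simp only [mem_preimage, Metric.mem_ball, ContinuousMap.coe_mk, mem_compl_iff,
        mem_singleton_iff]
      constructor
      · intro h
        exact (lt_max_of_lt_right (sub_pos.mpr h)).ne'
      · intro h
        by_contra h'
        exact h (max_eq_left (by linarith))) (by
      rw [eq_univ_iff_forall]
      intro x
      obtain ⟨e, he, hxe⟩ := mem_iUnion₂.mp (htc (mem_range_self x))
      exact ⟨_, by simpa using ⟨e, he, rfl⟩, hxe⟩)
  choose! φ hφ using h1
  have h3' : ∀ V ∈ 𝒱, ∃ e : E, V ⊆ F ⁻¹' Metric.ball e ε := by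
    intro V hV
    obtain ⟨U, hU, hVU⟩ := h3 V hV
    obtain ⟨e, he, rfl⟩ := Finset.mem_image.mp hU
    exact ⟨e, hVU⟩
  choose! c hc using h3'
  have hmem : ∀ V ∈ 𝒱, ∀ x, x ∈ V ↔ |φ V x| ≠ 0 := by
    intro V hV x
    conv_lhs => rw [hφ V hV]
    simp
  have hsum : ∀ x, 0 < ∑ V ∈ 𝒱, |φ V x| := by
    intro x
    obtain ⟨V, hV, hxV⟩ : x ∈ ⋃₀ (𝒱 : Set (Set X)) := h2 ▸ mem_univ x
    exact Finset.sum_pos' (fun _ _ => abs_nonneg _)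
      ⟨V, hV, lt_of_le_of_ne (abs_nonneg _) (((hmem V hV x).mp hxV).symm)⟩
  let T : X → Finset (Set X) := fun x => 𝒱.filter fun V => |φ V x| ≠ 0
  have hG : ∀ x, 𝒱.centerMass (fun V => |φ V x|) c = (T x).centerMass (fun V => |φ V x|) c :=
    fun x => (Finset.centerMass_filter_ne_zero c).symm
  have hTsum : ∀ x, 0 < ∑ V ∈ T x, |φ V x| := by
    intro x
    rw [Finset.sum_filter_ne_zero]
    exact hsum x
  refine ⟨⟨fun x => 𝒱.centerMass (fun V => |φ V x|) c, ?_⟩, ?_, ?_⟩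
  · unfold Finset.centerMass
    refine Continuous.smul (Continuous.inv₀ (by fun_prop) fun x => (hsum x).ne') (by fun_prop)
  · intro x
    rw [← dist_eq_norm, ContinuousMap.coe_mk, hG, ← Metric.mem_ball]
    refine (convex_ball (F x) ε).centerMass_mem (fun _ _ => abs_nonneg _) (hTsum x) ?_
    intro V hV
    rw [Finset.mem_filter] at hV
    have : x ∈ V := (hmem V hV.1 x).mpr hV.2
    rw [Metric.mem_ball, dist_comm]
    exact hc V hV.1 this
  · rw [← interior_eq_empty_iff_dense_compl]
    let _ : MeasurableSpace E := borel E
    have : BorelSpace E := ⟨rfl⟩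
    apply MeasureTheory.Measure.interior_eq_empty_of_null (μ := MeasureTheory.Measure.addHaar)
    refine MeasureTheory.measure_mono_null (t := ⋃ S ∈ 𝒱.powerset.filter fun S => S.card ≤ n + 1,
      (affineSpan ℝ (c '' (S : Set (Set X))) : Set E)) ?_ ?_
    · rintro _ ⟨x, rfl⟩
      rw [ContinuousMap.coe_mk, hG, mem_iUnion₂]
      refine ⟨T x, ?_, ?_⟩
      · rw [Finset.mem_filter, Finset.mem_powerset]
        refine ⟨Finset.filter_subset _ _, ?_⟩
        by_contra hcard
        have := h4 (T x) (Finset.filter_subset _ _) (by omega)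
        have hx : x ∈ ⋂₀ (T x : Set (Set X)) := by
          intro V hV
          rw [Finset.mem_coe, Finset.mem_filter] at hV
          exact (hmem V hV.1 x).mpr hV.2
        rw [this] at hx
        exact hx
      · exact convexHull_subset_affineSpan _ (Finset.centerMass_mem_convexHull _
          (fun _ _ => abs_nonneg _) (hTsum x) fun V hV => mem_image_of_mem _ hV)
    · refine (MeasureTheory.measure_biUnion_null_iff (Finset.countable_toSet _)).mpr ?_
      intro S hS
      have hS := (Finset.mem_filter.mp hS).2
      apply MeasureTheory.Measure.addHaar_affineSubspace
      intro htop
      have h5 : Module.finrank ℝ (vectorSpan ℝ (c '' (S : Set (Set X)))) = n + 1 := by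
        rw [← direction_affineSpan, htop, AffineSubspace.direction_top, finrank_top, hE]
      rcases Nat.eq_zero_or_pos S.card with h0 | h0
      · rw [Finset.card_eq_zero] at h0
        subst h0
        rw [Finset.coe_empty, image_empty, vectorSpan_empty, finrank_bot] at h5
        omega
      · obtain ⟨m, hm⟩ := Nat.exists_eq_succ_of_ne_zero h0.ne'
        have := finrank_vectorSpan_image_finset_le ℝ c S hm
        rw [Finset.coe_image] at this
        omega

theorem thin_sphere3 {E : Type} [NormedAddCommGroup E] [NormedSpace ℝ E] [FiniteDimensional ℝ E]
    (hE : Module.finrank ℝ E = 5) :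
    Thin (Metric.sphere (0 : EuclideanSpace ℝ (Fin 4)) 1) E := by
  intro F ε hε
  obtain ⟨F', hF'⟩ := ContinuousMap.exists_restrict_eq (Y := E) (Metric.isClosed_sphere) F
  obtain ⟨g, hg, hgF, -⟩ := F'.continuous.exists_contDiff_approx 1 (ε := fun _ => ε)
    continuous_const (fun _ => hε)
  refine ⟨⟨fun x => g x, hg.continuous.comp continuous_subtype_val⟩, fun x => ?_, ?_⟩
  · have h1 : F x = F' x := (DFunLike.congr_fun hF' x).symm
    rw [ContinuousMap.coe_mk, h1, ← dist_eq_norm]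
    exact hgF x
  · refine (ContDiff.dense_compl_range_of_finrank_lt_finrank (by simpa using hg)
      (by rw [hE]; simp)).mono ?_
    rw [compl_subset_compl]
    rintro _ ⟨x, rfl⟩
    exact mem_range_self _

/-- Abstract extension criterion. -/
theorem isAE_of_thin {X E Z : Type*} [TopologicalSpace X] [CompactSpace X] [T2Space X]
    [NormedAddCommGroup E]
    [NormedSpace ℝ E] [FiniteDimensional ℝ E] [TopologicalSpace Z] (i : Z → E) (hi : Continuous i)
    (hi0 : ∀ z, i z ≠ 0) (ρ : E → Z) (hρ : ContinuousOn ρ {0}ᶜ) (hρi : ∀ z, ρ (i z) = z)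
    (hX : Thin X E) : IsAE Z X := by
  intro Y hY f
  obtain ⟨F, hF⟩ := ContinuousMap.exists_restrict_eq (Y := E) hY ⟨fun y => i (f y), by fun_prop⟩
  have hFy : ∀ y : Y, F y = i (f y) := fun y => DFunLike.congr_fun hF y
  obtain ⟨c, hc, hcY⟩ : ∃ c > 0, ∀ y ∈ Y, 2 * c ≤ ‖F y‖ := by
    rcases Y.eq_empty_or_nonempty with rfl | hne
    · exact ⟨1, one_pos, by simp⟩
    obtain ⟨y, hy, hmin⟩ := hY.isCompact.exists_isMinOn hne
      (f := fun x => ‖F x‖) (by fun_prop)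
    refine ⟨‖F y‖ / 2, ?_, ?_⟩
    · rw [hFy ⟨y, hy⟩]
      exact half_pos (norm_pos_iff.mpr (hi0 _))
    · intro z hz
      have := hmin hz
      simp only [mem_ofPred_eq] at this
      linarith
  obtain ⟨G, hGF, hGd⟩ := hX F (c / 2) (by positivity)
  obtain ⟨p, hp, hpn⟩ := hGd.exists_dist_lt 0 (half_pos (half_pos hc))
  rw [dist_zero_left] at hpn
  -- `H = G - p` avoids zero
  let H : X → E := fun x => G x - p
  have hH : Continuous H := by fun_prop
  have hH0 : ∀ x, H x ≠ 0 := fun x h => hp ⟨x, sub_eq_zero.mp h⟩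
  have hHF : ∀ x, ‖H x - F x‖ < c := by
    intro x
    have h1 := hGF x
    have h2 : H x - F x = (G x - F x) - p := by simp only [H]; abel
    rw [h2]
    refine (norm_sub_le _ _).trans_lt (by linarith)
  let s : X → ℝ := fun x => max 1 (c / ‖H x‖)
  have hs : Continuous s := continuous_const.max
    (continuous_const.div hH.norm fun x => norm_ne_zero_iff.mpr (hH0 x))
  have hsH : ∀ x, c ≤ ‖s x • H x‖ := by
    intro x
    have h0 : 0 < ‖H x‖ := norm_pos_iff.mpr (hH0 x)
    rw [norm_smul, Real.norm_of_nonneg (le_trans zero_le_one (le_max_left _ _)),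
      ← div_le_iff₀ h0]
    exact le_max_right _ _
  have hsY : ∀ y ∈ Y, s y = 1 := by
    intro y hy
    have h0 : 0 < ‖H y‖ := norm_pos_iff.mpr (hH0 y)
    apply max_eq_left
    rw [div_le_one h0]
    have h1 := hcY y hy
    have h2 := hHF y
    have h3 := norm_sub_norm_le (F y) (H y)
    rw [norm_sub_rev (F y) (H y)] at h3
    linarith
  have hne : ∀ x, s x • H x + (F x - H x) ≠ 0 := by
    intro x h
    have h1 := hsH x
    rw [eq_neg_of_add_eq_zero_left h, norm_neg, norm_sub_rev] at h1
    linarith [hHF x]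
  refine ⟨⟨fun x => ρ (s x • H x + (F x - H x)), hρ.comp_continuous (by fun_prop) hne⟩, ?_⟩
  intro y
  rw [ContinuousMap.coe_mk, hsY y y.2, one_smul, add_sub_cancel, hFy, hρi]

theorem continuous_l1_of_fintype {V : Type*} [Fintype V] {X : Type*} [TopologicalSpace X]
    {g : X → lp (fun _ : V => ℝ) 1} (hg : ∀ v, Continuous fun x => g x v) : Continuous g := by
  rw [continuous_iff_continuousAt]
  intro a
  unfold ContinuousAt
  rw [tendsto_iff_norm_sub_tendsto_zero]
  simp only [l1_norm, tsum_fintype, lp.coeFn_sub, Pi.sub_apply]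
  have : Continuous fun x => ∑ v, |g x v - g a v| := by fun_prop
  simpa using this.tendsto a

theorem continuous_l1_coord {V : Type*} (v : V) :
    Continuous fun x : lp (fun _ : V => ℝ) 1 => x v := by
  refine LipschitzWith.continuous (K := 1) (LipschitzWith.of_dist_le_mul fun x y => ?_)
  rw [dist_eq_norm, dist_eq_norm, NNReal.coe_one, one_mul]
  exact l1_coord (x - y) v

/-- subtract the minimum -/
noncomputable def subMin {n : ℕ} (y : Fin (n + 1) → ℝ) (v : Fin (n + 2)) : ℝ :=
  (Fin.snoc y 0 : Fin (n + 2) → ℝ) v -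
    Finset.univ.inf' Finset.univ_nonempty (Fin.snoc y 0 : Fin (n + 2) → ℝ)

theorem subMin_nonneg {n : ℕ} (y : Fin (n + 1) → ℝ) (v : Fin (n + 2)) : 0 ≤ subMin y v :=
  sub_nonneg.mpr (Finset.inf'_le _ (Finset.mem_univ v))

theorem exists_subMin_eq_zero {n : ℕ} (y : Fin (n + 1) → ℝ) : ∃ v, subMin y v = 0 := by
  obtain ⟨v, -, hv⟩ := Finset.exists_mem_eq_inf' Finset.univ_nonempty
    (Fin.snoc y 0 : Fin (n + 2) → ℝ)
  exact ⟨v, sub_eq_zero.mpr hv.symm⟩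

theorem subMin_sum_pos {n : ℕ} {y : Fin (n + 1) → ℝ} (hy : y ≠ 0) : 0 < ∑ v, subMin y v := by
  refine lt_of_le_of_ne (Finset.sum_nonneg fun v _ => subMin_nonneg y v) fun h => hy ?_
  have h1 := (Finset.sum_eq_zero_iff_of_nonneg (fun v _ => subMin_nonneg y v)).mp h.symm
  have h2 := h1 (Fin.last _) (Finset.mem_univ _)
  funext j
  have h3 := h1 j.castSucc (Finset.mem_univ _)
  simp only [subMin, Fin.snoc_last, Fin.snoc_castSucc] at h2 h3
  simp only [Pi.zero_apply]
  linarith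

theorem continuous_subMin {n : ℕ} (v : Fin (n + 2)) :
    Continuous fun y : Fin (n + 1) → ℝ => subMin y v := by
  have h : ∀ v : Fin (n + 2), Continuous fun y : Fin (n + 1) → ℝ =>
      (Fin.snoc y 0 : Fin (n + 2) → ℝ) v := by
    intro v
    refine Fin.lastCases ?_ (fun j => ?_) v
    · simp only [Fin.snoc_last]; exact continuous_const
    · simp only [Fin.snoc_castSucc]; exact continuous_apply j
  exact (h v).sub (Continuous.finset_inf'_apply _ fun i _ => h i)

open Classical in
/-- radial map onto the boundary of the simplex -/
noncomputable def simplexRho (n : ℕ) (y : Fin (n + 1) → ℝ) : ↥(sphereComplex n).space :=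
  if hy : y = 0 then
    ⟨⟨fun v => if v = 0 then 1 else 0, l1_memlp (Summable.of_finite)⟩,
      {0}, ⟨by simp, fun h => by
        have := Finset.mem_univ (1 : Fin (n + 2))
        rw [← h] at this
        simp at this⟩, by
        intro v hv
        by_contra h
        simp only [Finset.mem_singleton] at h
        simp [h] at hv, by
        intro v
        simp only
        split_ifs <;> simp, by simp⟩
  else
    ⟨⟨fun v => (∑ v, subMin y v)⁻¹ * subMin y v, l1_memlp (Summable.of_finite)⟩,
      Finset.univ.filter (fun v => subMin y v ≠ 0), ⟨by
        by_contra h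
        rw [Finset.not_nonempty_iff_eq_empty, Finset.filter_eq_empty_iff] at h
        have := subMin_sum_pos hy
        rw [Finset.sum_eq_zero (fun v hv => not_not.mp (h hv))] at this
        exact lt_irrefl _ this, by
        intro h
        obtain ⟨v, hv⟩ := exists_subMin_eq_zero y
        have h1 := Finset.mem_univ v
        rw [← h] at h1
        simp [hv] at h1⟩, by
        intro v hv
        simp only [Finset.mem_filter, Finset.mem_univ, true_and]
        exact fun h => hv (by simp [h]), by
        intro v
        exact mul_nonneg (inv_nonneg.mpr (subMin_sum_pos hy).le) (subMin_nonneg _ _), by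
        simp only [← Finset.mul_sum]
        rw [Finset.sum_filter_ne_zero, inv_mul_cancel₀ (subMin_sum_pos hy).ne']⟩

theorem simplexRho_apply {n : ℕ} {y : Fin (n + 1) → ℝ} (hy : y ≠ 0) (v : Fin (n + 2)) :
    (simplexRho n y : lp (fun _ : Fin (n + 2) => ℝ) 1) v =
      (∑ v, subMin y v)⁻¹ * subMin y v := by
  simp only [simplexRho, dif_neg hy]

theorem isAE_sphere_of_thin {n : ℕ} {X : Type*} [TopologicalSpace X] [CompactSpace X] [T2Space X]
    (hX : Thin X (Fin (n + 1) → ℝ)) : IsAE ↥(sphereComplex n).space X := by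
  have key : ∀ z : ↥(sphereComplex n).space,
      ((∑ v, (z : lp (fun _ : Fin (n + 2) => ℝ) 1) v = 1) ∧
      (∃ v, (z : lp (fun _ : Fin (n + 2) => ℝ) 1) v = 0)) ∧
      ∀ v, 0 ≤ (z : lp (fun _ : Fin (n + 2) => ℝ) 1) v := by
    rintro ⟨z, s, ⟨hs1, hs2⟩, h1, h2, h3⟩
    refine ⟨⟨?_, ?_⟩, h2⟩
    · refine Eq.trans ?_ h3
      symm
      refine Finset.sum_subset (Finset.subset_univ s) fun v _ hv => ?_
      by_contra h
      exact hv (h1 v h)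
    · by_contra! h
      exact hs2 (Finset.eq_univ_iff_forall.mpr fun v => h1 v (h v))
  let i : ↥(sphereComplex n).space → (Fin (n + 1) → ℝ) := fun z j =>
    (z : lp (fun _ : Fin (n + 2) => ℝ) 1) j.castSucc -
      (z : lp (fun _ : Fin (n + 2) => ℝ) 1) (Fin.last _)
  have hi : Continuous i := continuous_pi fun j =>
    ((continuous_l1_coord _).comp continuous_subtype_val).sub
      ((continuous_l1_coord _).comp continuous_subtype_val)
  have hsnoc : ∀ z, (Fin.snoc (i z) 0 : Fin (n + 2) → ℝ) = fun v =>
      (z : lp (fun _ : Fin (n + 2) => ℝ) 1) v -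
      (z : lp (fun _ : Fin (n + 2) => ℝ) 1) (Fin.last _) := by
    intro z
    funext v
    refine Fin.lastCases ?_ (fun j => ?_) v
    · simp
    · simp [i]
  have hsub : ∀ z v, subMin (i z) v = (z : lp (fun _ : Fin (n + 2) => ℝ) 1) v := by
    intro z v
    obtain ⟨⟨h1, w, hw⟩, h3⟩ := key z
    have : Finset.univ.inf' Finset.univ_nonempty (Fin.snoc (i z) 0 : Fin (n + 2) → ℝ) =
        - (z : lp (fun _ : Fin (n + 2) => ℝ) 1) (Fin.last _) := by
      rw [hsnoc]
      apply le_antisymm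
      · refine (Finset.inf'_le _ (Finset.mem_univ w)).trans ?_
        simp [hw]
      · refine Finset.le_inf' _ _ fun v _ => ?_
        have := h3 v
        linarith
    simp only [subMin, this]
    rw [hsnoc]
    ring
  have hi0 : ∀ z, i z ≠ 0 := by
    intro z h0
    obtain ⟨⟨h1, w, hw⟩, h3⟩ := key z
    have h4 : ∀ v, (z : lp (fun _ : Fin (n + 2) => ℝ) 1) v =
        (z : lp (fun _ : Fin (n + 2) => ℝ) 1) (Fin.last _) := by
      intro v
      have := congrFun (hsnoc z) v
      rw [h0] at this
      have h5 : (Fin.snoc (0 : Fin (n + 1) → ℝ) 0 : Fin (n + 2) → ℝ) v = 0 := by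
        refine Fin.lastCases ?_ (fun j => ?_) v <;> simp
      rw [h5] at this
      linarith
    have h6 : ∀ v, (z : lp (fun _ : Fin (n + 2) => ℝ) 1) v = 0 := fun v => by
      rw [h4 v, ← h4 w, hw]
    simp [h6] at h1
  refine isAE_of_thin i hi hi0 (simplexRho n) ?_ ?_ hX
  · rw [continuousOn_iff_continuous_domRestrict]
    refine continuous_induced_rng.mpr (continuous_l1_of_fintype fun v => ?_)
    have hcongr : ∀ y : ({0}ᶜ : Set (Fin (n + 1) → ℝ)),
        (∑ v, subMin (y : Fin (n + 1) → ℝ) v)⁻¹ * subMin (y : Fin (n + 1) → ℝ) v =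
        ((simplexRho n y : ↥(sphereComplex n).space) : lp (fun _ : Fin (n + 2) => ℝ) 1) v :=
      fun y => (simplexRho_apply y.2 v).symm
    refine Continuous.congr ?_ hcongr
    refine Continuous.mul (Continuous.inv₀ ?_ fun y => (subMin_sum_pos y.2).ne') ?_
    · exact continuous_finsetSum _ fun v _ => (continuous_subMin v).comp continuous_subtype_val
    · exact (continuous_subMin v).comp continuous_subtype_val
  · intro z
    apply Subtype.ext
    ext v
    rw [simplexRho_apply (hi0 z)]
    simp only [hsub]
    rw [(key z).1.1]
    simp


theorem extend_stoneCech {M E : Type*} [TopologicalSpace M] [MetricSpace E]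
    (hM : CountablyCompact M) {h : M → E} (hh : Continuous h) :
    ∃ k : StoneCech M → E, Continuous k ∧ (∀ m, k (stoneCechUnit m) = h m) ∧
      ∀ x, k x ∈ range h := by
  have hc : IsCompact (range h) := hM.isCompact_range hh
  have : CompactSpace (range h) := isCompact_iff_compactSpace.mp hc
  have hg : Continuous (rangeFactorization h) := hh.rangeFactorization
  refine ⟨fun x => ((stoneCechExtend hg x : range h) : E),
    continuous_subtype_val.comp (continuous_stoneCechExtend hg), fun m => ?_, fun x => ?_⟩
  · have := congrFun (stoneCechExtend_extends hg) m
    simp only [Function.comp_apply] at this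
    exact congrArg Subtype.val this
  · exact (stoneCechExtend hg x).2

theorem aes_stoneCech_of_isAE {M : Type*} [TopologicalSpace M]
    (hM : CountablyCompact M) {V : Type v} (K : SimpComplex V) (hK : IsAE ↥K.space M) :
    AES K.space (univ : Set (StoneCech M)) := by
  intro B _ hB f hf hfK
  obtain ⟨G, g, hG, hBG, hg, hgK, hgf⟩ := K.ane hB hf hfK
  obtain ⟨N, hN, hBN, hNG⟩ := normal_exists_closure_subset hB hG hBG
  have hK' := aes_of_isAE (X := M) IsClosedEmbedding.id hK
  rw [range_id] at hK'
  obtain ⟨h, hh, hhK, hhg⟩ := hK' (stoneCechUnit ⁻¹' closure N) (subset_univ _)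
    (isClosed_closure.preimage continuous_stoneCechUnit) (g ∘ stoneCechUnit)
    (hg.comp continuous_stoneCechUnit.continuousOn fun x hx => hNG hx)
    (fun x hx => hgK (hNG hx))
  rw [continuousOn_univ] at hh
  obtain ⟨k, hk, hkh, hkr⟩ := extend_stoneCech hM hh
  refine ⟨k, hk.continuousOn, ?_, ?_⟩
  · intro x _
    obtain ⟨m, hm⟩ := hkr x
    rw [← hm]; exact hhK (mem_univ m)
  · have h1 : EqOn k g (N ∩ range stoneCechUnit) := by
      rintro _ ⟨hx, m, rfl⟩
      rw [hkh]
      exact hhg (subset_closure hx : stoneCechUnit m ∈ closure N)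
    have h2 : EqOn k g N := h1.of_subset_closure hk.continuousOn
      (hg.mono (subset_closure.trans hNG)) inter_subset_left
      (denseRange_stoneCechUnit.open_subset_closure_inter hN)
    intro b hb
    rw [h2 (hBN hb), hgf hb]

theorem isAE_of_aes_stoneCech {M : Type*} [TopologicalSpace M] [NormalSpace M]
    (hM : CountablyCompact M) {V : Type v} (K : SimpComplex V)
    (hK : AES K.space (univ : Set (StoneCech M))) : IsAE ↥K.space M := by
  apply isAE_of_aes (X := M) IsClosedEmbedding.id
  rw [range_id]
  intro B _ hB f hf hfK
  have hBc : CountablyCompact B := by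
    intro 𝒰 ho hc
    choose O hO hOU using fun n => isOpen_induced_iff.mp (ho n)
    obtain ⟨t, ht⟩ := hM (fun n => O n ∪ Bᶜ) (fun n => (hO n).union hB.isOpen_compl) (by
      rw [eq_univ_iff_forall]
      intro x
      by_cases hx : x ∈ B
      · have : (⟨x, hx⟩ : B) ∈ ⋃ n, 𝒰 n := hc ▸ mem_univ _
        obtain ⟨n, hn⟩ := mem_iUnion.mp this
        rw [← hOU n] at hn
        exact mem_iUnion.mpr ⟨n, Or.inl hn⟩
      · exact mem_iUnion.mpr ⟨0, Or.inr hx⟩)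
    refine ⟨t, eq_univ_iff_forall.mpr fun x => ?_⟩
    have : (x : M) ∈ ⋃ n ∈ t, (O n ∪ Bᶜ) := ht ▸ mem_univ _
    obtain ⟨n, hn, hx⟩ := mem_iUnion₂.mp this
    refine mem_iUnion₂.mpr ⟨n, hn, ?_⟩
    rw [← hOU n]
    exact hx.resolve_right fun h => h x.2
  have hA : IsCompact (f '' B) := by
    have := hBc.isCompact_range (continuousOn_iff_continuous_domRestrict.mp hf)
    rwa [range_domRestrict] at this
  obtain ⟨F, hF, hFf⟩ := tietze_banach hB hA hf (mapsTo_image f B)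
  obtain ⟨k, hk, hkF, -⟩ := extend_stoneCech hM hF
  have hkA : MapsTo k (closure (stoneCechUnit '' B)) (f '' B) := by
    have : closure (stoneCechUnit '' B) ⊆ k ⁻¹' (f '' B) := by
      refine closure_minimal ?_ (hA.isClosed.preimage hk)
      rintro _ ⟨b, hb, rfl⟩
      exact ⟨b, hb, by rw [hkF, hFf hb]⟩
    exact this
  obtain ⟨g, hg, hgK, hgk⟩ := hK (closure (stoneCechUnit '' B)) (subset_univ _) isClosed_closure k
    hk.continuousOn (hkA.mono_right (by rintro _ ⟨b, hb, rfl⟩; exact hfK hb))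
  refine ⟨g ∘ stoneCechUnit, hg.comp continuous_stoneCechUnit.continuousOn fun _ _ => mem_univ _,
    fun m _ => hgK (mem_univ _), fun b hb => ?_⟩
  rw [Function.comp_apply, hgk (subset_closure (mem_image_of_mem _ hb)), hkF, hFf hb]

theorem covDimLE_of_covDim_le {X : Type*} [TopologicalSpace X] {n : ℕ} (h : covDim X ≤ (n : ℕ∞)) :
    CovDimLE X n := by
  have hne : ((↑) '' {n : ℕ | CovDimLE X n} : Set ℕ∞).Nonempty := by
    by_contra hne
    rw [not_nonempty_iff_eq_empty] at hne
    rw [covDim, hne, sInf_empty] at h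
    exact absurd h (by simp)
  obtain ⟨m, hm, hme⟩ := csInf_mem hne
  have hmn : m ≤ n := by
    have : (m : ℕ∞) ≤ n := by rw [hme]; exact h
    exact_mod_cast this
  intro 𝒰 h1 h2
  obtain ⟨𝒱, h3, h4, h5, h6⟩ := hm 𝒰 h1 h2
  exact ⟨𝒱, h3, h4, h5, fun 𝒲 h7 h8 => h6 𝒲 h7 (by omega)⟩


/-- If a normal countably compact space `M` has Stone–Čech remainder homeomorphic to the
disjoint sum of a metrizable compactum `C` and an open subset `U` of `S³`, every compact
subset of `M` has covering dimension `≤ 4`, and `L` is a complex with `[S⁴] ≤ [L]` and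
`e-dim C = [L]`, then `e-dim M = [L]`. -/
theorem eDim_of_remainder (M : Type u) [TopologicalSpace M] [NormalSpace M] [T35Space M]
    (hM : CountablyCompact M)
    (C : Type u) [TopologicalSpace C] [CompactSpace C]
    [TopologicalSpace.MetrizableSpace C]
    (U : Set (Metric.sphere (0 : EuclideanSpace ℝ (Fin 4)) 1)) (hU : IsOpen U)
    (hrem : Nonempty (↥(StoneCechRemainder M) ≃ₜ (C ⊕ ↥U)))
    (hcmp : ∀ K : Set M, IsCompact K → covDim ↥K ≤ (4 : ℕ∞))
    {W : Type w} (L : SimpComplex W)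
    (hS4 : extLE.{u} (sphereComplex 4) L)
    (hC : eDimEq C L) :
    eDimEq M L := by
  classical
  obtain ⟨φ⟩ := hrem
  set R : Set (StoneCech M) := StoneCechRemainder M with hR
  -- compact subsets of `M` seen in `βM`
  have hcM : ∀ Y : Set (StoneCech M), IsClosed Y → Y ⊆ Rᶜ → AES L.space Y := by
    intro Y hY hYR
    have hemb := (isDenseEmbedding_stoneCechUnit (X := M)).isEmbedding
    have hYr : Y ⊆ range (stoneCechUnit : M → StoneCech M) := by
      intro y hy
      by_contra h
      exact hYR hy h
    have himg : stoneCechUnit '' (stoneCechUnit ⁻¹' Y : Set M) = Y := image_preimage_eq_of_subset hYr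
    have hKc : IsCompact (stoneCechUnit ⁻¹' Y : Set M) := by
      rw [hemb.isInducing.isCompact_iff, himg]
      exact hY.isCompact
    have hcs : CompactSpace (stoneCechUnit ⁻¹' Y : Set M) := isCompact_iff_compactSpace.mp hKc
    have h1 : CovDimLE (stoneCechUnit ⁻¹' Y : Set M) 4 := covDimLE_of_covDim_le (hcmp _ hKc)
    have h2 : IsAE ↥(sphereComplex 4).space (stoneCechUnit ⁻¹' Y : Set M) :=
      isAE_sphere_of_thin (thin_of_covDimLE (by simp) h1)
    have h3 : IsAE ↥L.space (stoneCechUnit ⁻¹' Y : Set M) :=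
      hS4 _ _ inferInstance (countablyCompact_of_compact _) h2
    have he : IsClosedEmbedding (fun m : (stoneCechUnit ⁻¹' Y : Set M) =>
        (stoneCechUnit (m : M) : StoneCech M)) :=
      (continuous_stoneCechUnit.comp continuous_subtype_val).isClosedEmbedding
        (hemb.injective.comp Subtype.val_injective)
    have h4 := aes_of_isAE he h3
    have h5 : range (fun m : (stoneCechUnit ⁻¹' Y : Set M) =>
        (stoneCechUnit (m : M) : StoneCech M)) = Y := by
      have h6 := range_comp (stoneCechUnit : M → StoneCech M)
        (Subtype.val : (stoneCechUnit ⁻¹' Y : Set M) → M)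
      rw [Subtype.range_coe, himg] at h6
      exact h6
    rwa [h5] at h4
  -- the copy of `C`
  let iC : C → StoneCech M := fun c => (φ.symm (Sum.inl c) : StoneCech M)
  have hiC : IsClosedEmbedding iC :=
    (continuous_subtype_val.comp (φ.symm.continuous.comp continuous_inl)).isClosedEmbedding
      (Subtype.val_injective.comp (φ.symm.injective.comp Sum.inl_injective))
  have hCL : AES L.space (range iC) := aes_of_isAE hiC hC.1
  have hCR : range iC ⊆ R := by
    rintro _ ⟨c, rfl⟩
    exact (φ.symm (Sum.inl c)).2
  -- compact subsets of the copy of `U`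
  have hUL : ∀ Y : Set (StoneCech M), IsClosed Y → Y ⊆ R \ range iC → AES L.space Y := by
    intro Y hY hYR
    have hcs : CompactSpace Y := isCompact_iff_compactSpace.mp hY.isCompact
    have hex : ∀ y : Y, ∃ u : U, φ ⟨y, (hYR y.2).1⟩ = Sum.inr u := by
      intro y
      rcases h : φ ⟨y, (hYR y.2).1⟩ with c | u
      · exfalso
        apply (hYR y.2).2
        refine ⟨c, ?_⟩
        simp only [iC, ← h, Homeomorph.symm_apply_apply]
      · exact ⟨u, rfl⟩
    choose p hp using hex
    have hpc : Continuous p := by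
      rw [(IsOpenEmbedding.inr (X := C) (Y := U)).isInducing.continuous_iff]
      have : (Sum.inr ∘ p : Y → C ⊕ U) = fun y : Y => φ ⟨y, (hYR y.2).1⟩ := by
        funext y; exact (hp y).symm
      rw [this]
      fun_prop
    have hpi : Function.Injective p := by
      intro y z hyz
      have h1 : φ ⟨y, (hYR y.2).1⟩ = φ ⟨z, (hYR z.2).1⟩ := by rw [hp, hp, hyz]
      have h2 := φ.injective h1
      rw [Subtype.mk.injEq] at h2
      exact Subtype.ext h2
    have he : IsClosedEmbedding (fun y : Y =>
        (p y : Metric.sphere (0 : EuclideanSpace ℝ (Fin 4)) 1)) :=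
      (continuous_subtype_val.comp hpc).isClosedEmbedding (Subtype.val_injective.comp hpi)
    have h1 : IsAE ↥(sphereComplex 4).space (Metric.sphere (0 : EuclideanSpace ℝ (Fin 4)) 1) :=
      isAE_sphere_of_thin (thin_sphere3 (by simp))
    have h2 := aes_of_isAE IsClosedEmbedding.id h1
    rw [range_id] at h2
    have h3 : IsAE ↥(sphereComplex 4).space Y := isAE_of_aes he (h2.mono (subset_univ _))
    have h4 : IsAE ↥L.space Y := hS4 _ _ inferInstance (countablyCompact_of_compact _) h3
    have h5 := aes_of_isAE hY.isClosedEmbedding_subtypeVal h4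
    rwa [Subtype.range_coe] at h5
  -- the remainder is locally compact, hence open in its closure
  have hloc : ∀ x ∈ R, ∃ (O K : Set (StoneCech M)), IsOpen O ∧ x ∈ O ∧ IsClosed K ∧
      O ∩ R ⊆ K ∧ K ⊆ R := by
    have main : ∀ z : C ⊕ U, ∃ Q : Set (C ⊕ U), IsCompact Q ∧ Q ∈ 𝓝 z := by
      have : LocallyCompactSpace U := hU.locallyCompactSpace
      rintro (c | u)
      · exact ⟨range Sum.inl, isCompact_range continuous_inl,
          isOpen_range_inl.mem_nhds (mem_range_self c)⟩
      · obtain ⟨Q, hQ, hQu⟩ := exists_compact_mem_nhds u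
        exact ⟨Sum.inr '' Q, hQ.image continuous_inr,
          IsOpenEmbedding.inr.isOpenMap.image_mem_nhds hQu⟩
    intro x hx
    obtain ⟨Q, hQ, hQx⟩ := main (φ ⟨x, hx⟩)
    have h1 : φ ⁻¹' Q ∈ 𝓝 (⟨x, hx⟩ : R) := φ.continuous.continuousAt.preimage_mem_nhds hQx
    rw [nhds_subtype_eq_comap, Filter.mem_comap] at h1
    obtain ⟨S, hS, hSQ⟩ := h1
    obtain ⟨O, hOS, hO, hxO⟩ := mem_nhds_iff.mp hS
    have hK : IsCompact (Subtype.val '' (φ ⁻¹' Q : Set R)) :=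
      ((φ.isCompact_preimage).mpr hQ).image continuous_subtype_val
    refine ⟨O, _, hO, hxO, hK.isClosed, ?_, ?_⟩
    · rintro y ⟨hyO, hyR⟩
      exact ⟨⟨y, hyR⟩, hSQ (hOS hyO), rfl⟩
    · rintro _ ⟨y, -, rfl⟩
      exact y.2
  have hD : IsClosed (closure R \ R) := by
    rw [← isOpen_compl_iff, isOpen_iff_mem_nhds]
    intro x hx
    by_cases hxR : x ∈ R
    · obtain ⟨O, K, hO, hxO, hK, hOK, hKR⟩ := hloc x hxR
      refine Filter.mem_of_superset (hO.mem_nhds hxO) ?_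
      rintro y hyO ⟨hyc, hyR⟩
      apply hyR
      apply hKR
      have h1 : y ∈ closure (O ∩ R) := hO.inter_closure ⟨hyO, hyc⟩
      exact closure_minimal hOK hK h1
    · have hxc : x ∉ closure R := fun h => hx ⟨h, hxR⟩
      refine Filter.mem_of_superset (isClosed_closure.isOpen_compl.mem_nhds hxc) ?_
      intro y hy h
      exact hy h.1
  have hCD : AES L.space (range iC ∪ closure R \ R) := by
    refine aes_union L (hiC.isClosed_range.union hD) hiC.isClosed_range subset_union_left hCL ?_
    intro Y hY hYc
    refine hcM Y hYc fun y hy => ?_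
    exact ((hY hy).1.resolve_left (hY hy).2).2
  have hRcl : AES L.space (closure R) := by
    refine aes_union L isClosed_closure (hiC.isClosed_range.union hD)
      (union_subset (hCR.trans subset_closure) sdiff_subset) hCD ?_
    intro Y hY hYc
    refine hUL Y hYc fun y hy => ⟨?_, fun h => (hY hy).2 (Or.inl h)⟩
    by_contra h
    exact (hY hy).2 (Or.inr ⟨(hY hy).1, h⟩)
  have hX : AES L.space (univ : Set (StoneCech M)) := by
    refine aes_union L isClosed_univ isClosed_closure (subset_univ _) hRcl ?_
    intro Y hY hYc
    exact hcM Y hYc fun y hy hyR => (hY hy).2 (subset_closure hyR)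
  refine ⟨isAE_of_aes_stoneCech hM L hX, fun V K hK => hC.2 V K ?_⟩
  exact isAE_of_aes hiC ((aes_stoneCech_of_isAE hM K hK).mono (subset_univ _))
end

section
/- Let M be a normal countably compact space such that βM \ M is the disjoint union of a metrizable compactum C and an open subset of S³, where C is infinite dimensional but every compact subset of C of positive dimension does not exist (C has no positive-dimensional compact subsets), and every compact subset of M has dim ≤ 4. Then for every closed subset F ⊆ M, either dim F ≤ 4 or dim F = ∞. -/
open Set Topology

universe u v w

/-- Indexed form of `dim S ≤ n` for a subset `S` of a space `Y`. -/
def RelDim {Y : Type*} [TopologicalSpace Y] (S : Set Y) (n : ℕ) : Prop :=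
  ∀ (k : ℕ) (U : Fin k → Set Y), (∀ i, IsOpen (U i)) → S ⊆ ⋃ i, U i →
    ∃ V : Fin k → Set Y, (∀ i, IsOpen (V i)) ∧ (∀ i, V i ⊆ U i) ∧ S ⊆ ⋃ i, V i ∧
      ∀ x ∈ S, ∀ T : Finset (Fin k), (∀ i ∈ T, x ∈ V i) → T.card ≤ n + 1

theorem RelDim.mono_n {Y : Type*} [TopologicalSpace Y] {S : Set Y} {n m : ℕ} (h : RelDim S n)
    (hnm : n ≤ m) : RelDim S m := by
  intro k U hU hS
  obtain ⟨V, h1, h2, h3, h4⟩ := h k U hU hS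
  exact ⟨V, h1, h2, h3, fun x hx T hT => (h4 x hx T hT).trans (by omega)⟩

theorem RelDim.mono {Y : Type*} [TopologicalSpace Y] {S K : Set Y} {n : ℕ} (h : RelDim S n)
    (hK : IsClosed K) (hKS : K ⊆ S) : RelDim K n := by
  intro k U hU hcov
  obtain ⟨V, h1, h2, h3, h4⟩ := h (k + 1) (Fin.snoc (α := fun _ => Set Y) U Kᶜ)
    (by
      intro i
      refine Fin.lastCases ?_ (fun i => ?_) i
      · simpa using hK
      · simpa using hU i)
    (by
      intro x hx
      by_cases hxK : x ∈ K
      · obtain ⟨i, hi⟩ := mem_iUnion.1 (hcov hxK)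
        exact mem_iUnion.2 ⟨i.castSucc, by simpa using hi⟩
      · exact mem_iUnion.2 ⟨Fin.last k, by simpa using hxK⟩)
  refine ⟨fun i => V i.castSucc, fun i => h1 _, fun i => by simpa using h2 i.castSucc, ?_, ?_⟩
  · intro x hx
    obtain ⟨i, hi⟩ := mem_iUnion.1 (h3 (hKS hx))
    revert hi
    refine Fin.lastCases (fun hi => ?_) (fun i hi => mem_iUnion.2 ⟨i, hi⟩) i
    have := h2 _ hi
    simp at this
    exact absurd hx this
  · intro x hx T hT
    have := h4 x (hKS hx) (T.map Fin.castSuccEmb) (by simpa using hT)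
    simpa using this

theorem relDim_image_iff {X Y : Type*} [TopologicalSpace X] [TopologicalSpace Y] {f : X → Y}
    (hf : IsInducing f) (S : Set X) (n : ℕ) : RelDim (f '' S) n ↔ RelDim S n := by
  constructor
  · intro h k U hU hcov
    choose U' hU' hUU using fun i => hf.isOpen_iff.1 (hU i)
    obtain ⟨V, h1, h2, h3, h4⟩ := h k U' hU' (by
      rintro _ ⟨x, hx, rfl⟩
      obtain ⟨i, hi⟩ := mem_iUnion.1 (hcov hx)
      rw [← hUU i] at hi
      exact mem_iUnion.2 ⟨i, hi⟩)
    refine ⟨fun i => f ⁻¹' V i, fun i => (h1 i).preimage hf.continuous, fun i => ?_, ?_, ?_⟩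
    · rw [← hUU i]; exact preimage_mono (h2 i)
    · intro x hx
      obtain ⟨i, hi⟩ := mem_iUnion.1 (h3 (mem_image_of_mem f hx))
      exact mem_iUnion.2 ⟨i, hi⟩
    · intro x hx T hT
      exact h4 (f x) (mem_image_of_mem f hx) T hT
  · intro h k U hU hcov
    obtain ⟨V, h1, h2, h3, h4⟩ := h k (fun i => f ⁻¹' U i)
      (fun i => (hU i).preimage hf.continuous) (by
      intro x hx
      obtain ⟨i, hi⟩ := mem_iUnion.1 (hcov (mem_image_of_mem f hx))
      exact mem_iUnion.2 ⟨i, hi⟩)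
    choose V' hV' hVV using fun i => hf.isOpen_iff.1 (h1 i)
    have key : ∀ i x, f x ∈ V' i ↔ x ∈ V i := fun i x => by rw [← hVV i]; rfl
    refine ⟨fun i => V' i ∩ U i, fun i => (hV' i).inter (hU i), fun i => inter_subset_right, ?_, ?_⟩
    · rintro _ ⟨x, hx, rfl⟩
      obtain ⟨i, hi⟩ := mem_iUnion.1 (h3 hx)
      exact mem_iUnion.2 ⟨i, (key i x).2 hi, h2 i hi⟩
    · rintro _ ⟨x, hx, rfl⟩ T hT
      exact h4 x hx T fun i hi => (key i x).1 (hT i hi).1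

theorem exists_functionallyOpen_shrink {X : Type*} [TopologicalSpace X] [NormalSpace X] {ι : Type*}
    [Finite ι] (U : ι → Set X) (hU : ∀ i, IsOpen (U i)) (hc : ⋃ i, U i = univ) :
    ∃ V : ι → Set X, (∀ i, FunctionallyOpen (V i)) ∧ (∀ i, V i ⊆ U i) ∧ ⋃ i, V i = univ := by
  obtain ⟨v, hv, hvc, hvu⟩ := exists_iUnion_eq_closed_subset hU (fun x => Set.toFinite _) hc
  have := fun i => exists_continuous_zero_one_of_isClosed (hU i).isClosed_compl (hvc i)
    (by rw [disjoint_compl_left_iff_subset]; exact hvu i)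
  choose f hf0 hf1 _ using this
  refine ⟨fun i => f i ⁻¹' {0}ᶜ, fun i => ⟨f i, rfl⟩, fun i x hx => ?_, ?_⟩
  · by_contra hxU
    exact hx (hf0 i hxU)
  · refine eq_univ_of_forall fun x => ?_
    obtain ⟨i, hi⟩ := mem_iUnion.1 (hv.ge (mem_univ x))
    refine mem_iUnion.2 ⟨i, ?_⟩
    have := hf1 i hi
    simp [this]

theorem FunctionallyOpen.isOpen {X : Type*} [TopologicalSpace X] {U : Set X}
    (h : FunctionallyOpen U) : IsOpen U := by
  obtain ⟨φ, rfl⟩ := h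
  exact isOpen_compl_singleton.preimage φ.continuous

theorem covDimLE_iff_univ {X : Type*} [TopologicalSpace X] [NormalSpace X] (n : ℕ) :
    CovDimLE X n ↔ RelDim (univ : Set X) n := by
  classical
  constructor
  · intro h k U hU hcov
    obtain ⟨U', hU'f, hU'U, hU'c⟩ := exists_functionallyOpen_shrink U hU (univ_subset_iff.1 hcov)
    obtain ⟨𝒱, hf, hc, hr, ho⟩ := h (Finset.univ.image U') (by simpa using hU'f)
      (by simpa using hU'c)
    have : ∀ V : 𝒱, ∃ i, (V : Set X) ⊆ U' i := by
      rintro ⟨V, hV⟩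
      obtain ⟨W, hW, hVW⟩ := hr V hV
      obtain ⟨i, -, rfl⟩ := Finset.mem_image.1 hW
      exact ⟨i, hVW⟩
    choose g hg using this
    refine ⟨fun i => ⋃ V : {V : 𝒱 // g V = i}, (V.1 : Set X), fun i => ?_, fun i => ?_, ?_, ?_⟩
    · exact isOpen_iUnion fun V => (hf _ V.1.2).isOpen
    · refine iUnion_subset ?_
      rintro ⟨V, rfl⟩
      exact (hg V).trans (hU'U _)
    · intro x hx
      rw [← hc] at hx
      obtain ⟨V, hV, hxV⟩ := hx
      exact mem_iUnion.2 ⟨g ⟨V, hV⟩, mem_iUnion.2 ⟨⟨⟨V, hV⟩, rfl⟩, hxV⟩⟩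
    · intro x _ T hT
      have : ∀ i : T, ∃ V : 𝒱, g V = i ∧ x ∈ (V : Set X) := by
        rintro ⟨i, hi⟩
        obtain ⟨⟨V, hV⟩, hx⟩ := mem_iUnion.1 (hT i hi)
        exact ⟨V, hV, hx⟩
      choose w hw hxw using this
      have hinj : Function.Injective (fun i : T => (w i : Set X)) := by
        intro i j hij
        have : w i = w j := Subtype.ext hij
        apply Subtype.ext
        rw [← hw i, ← hw j, this]
      by_contra hlt
      have := ho (Finset.univ.image (fun i : T => (w i : Set X))) (by
        intro V hV
        obtain ⟨i, -, rfl⟩ := Finset.mem_image.1 hV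
        exact (w i).2) (by
        rw [Finset.card_image_of_injective _ hinj]
        simpa using hlt)
      have hx : x ∈ ⋂₀ ((Finset.univ.image (fun i : T => (w i : Set X)) : Finset (Set X)) :
          Set (Set X)) := by
        intro V hV
        obtain ⟨i, -, rfl⟩ := Finset.mem_image.1 (Finset.mem_coe.1 hV)
        exact hxw i
      rw [this] at hx
      exact hx
  · intro h 𝒰 hf hc
    let e := 𝒰.equivFin
    obtain ⟨V, h1, h2, h3, h4⟩ := h 𝒰.card (fun i => (e.symm i : Set X))
      (fun i => (hf _ (e.symm i).2).isOpen) (by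
        intro x hx
        rw [← hc] at hx
        obtain ⟨V, hV, hxV⟩ := hx
        exact mem_iUnion.2 ⟨e ⟨V, hV⟩, by simpa using hxV⟩)
    obtain ⟨V', hf', hV'V, hc'⟩ := exists_functionallyOpen_shrink V h1 (univ_subset_iff.1 h3)
    refine ⟨Finset.univ.image V', by simpa using hf', by simpa using hc', ?_, ?_⟩
    · intro W hW
      obtain ⟨i, -, rfl⟩ := Finset.mem_image.1 hW
      exact ⟨_, (e.symm i).2, (hV'V i).trans (h2 i)⟩
    · intro 𝒲 hsub hcard
      by_contra hne
      obtain ⟨x, hx⟩ := nonempty_iff_ne_empty.2 hne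
      have : ∀ W : 𝒲, ∃ i, V' i = W := by
        rintro ⟨W, hW⟩
        obtain ⟨i, -, hi⟩ := Finset.mem_image.1 (hsub hW)
        exact ⟨i, hi⟩
      choose g hg using this
      have hinj : Function.Injective g := by
        intro a b hab
        apply Subtype.ext
        rw [← hg a, ← hg b, hab]
      have := h4 x (mem_univ x) (Finset.univ.image g) (by
        intro i hi
        obtain ⟨W, -, rfl⟩ := Finset.mem_image.1 hi
        apply hV'V
        rw [hg W]
        exact hx _ W.2)
      rw [Finset.card_image_of_injective _ hinj] at this
      simp at this
      omega

theorem covDimLE_iff {Y : Type*} [TopologicalSpace Y] (S : Set Y) [NormalSpace S] (n : ℕ) :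
    CovDimLE S n ↔ RelDim S n := by
  rw [covDimLE_iff_univ, ← relDim_image_iff (f := ((↑) : S → Y)) IsInducing.subtypeVal]
  simp

theorem exists_of_covDim_ne_top {X : Type*} [TopologicalSpace X] (h : covDim X ≠ ⊤) :
    ∃ n : ℕ, covDim X = n ∧ CovDimLE X n := by
  have hne : (((↑) : ℕ → ℕ∞) '' {n : ℕ | CovDimLE X n}).Nonempty := by
    by_contra hn
    rw [not_nonempty_iff_eq_empty] at hn
    apply h
    rw [covDim, hn, sInf_empty]
  obtain ⟨n, hn, he⟩ := csInf_mem hne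
  exact ⟨n, he.symm, hn⟩

theorem covDim_le_of {X : Type*} [TopologicalSpace X] {n : ℕ} (h : CovDimLE X n) :
    covDim X ≤ n := sInf_le ⟨n, h, rfl⟩

theorem covDim_le_iff {Y : Type*} [TopologicalSpace Y] (S : Set Y) [NormalSpace S] (n : ℕ) :
    covDim S ≤ n ↔ RelDim S n := by
  rw [← covDimLE_iff]
  refine ⟨fun h => ?_, covDim_le_of⟩
  obtain ⟨m, hm, hd⟩ := exists_of_covDim_ne_top (X := S) (ne_top_of_le_ne_top (by simp) h)
  rw [hm] at h
  rw [covDimLE_iff] at hd ⊢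
  exact hd.mono_n (by exact_mod_cast h)

/-- Swelling of a finite closed family. -/
theorem exists_swelling {Y : Type*} [TopologicalSpace Y] [NormalSpace Y] {k n : ℕ}
    (H U : Fin k → Set Y) (hH : ∀ i, IsClosed (H i)) (hU : ∀ i, IsOpen (U i))
    (hHU : ∀ i, H i ⊆ U i)
    (ho : ∀ x, ∀ T : Finset (Fin k), (∀ i ∈ T, x ∈ H i) → T.card ≤ n + 1) :
    ∃ G : Fin k → Set Y, (∀ i, IsOpen (G i)) ∧ (∀ i, H i ⊆ G i) ∧ (∀ i, G i ⊆ U i) ∧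
      ∀ x, ∀ T : Finset (Fin k), (∀ i ∈ T, x ∈ G i) → T.card ≤ n + 1 := by
  classical
  have : ∀ T : {T : Finset (Fin k) // n + 1 < T.card}, ∃ D : Fin k → Set Y,
      (∀ i, IsClosed (D i)) ∧ (∀ i ∈ T.1, Disjoint (D i) (H i)) ∧ ∀ x, ∃ i ∈ T.1, x ∈ D i := by
    rintro ⟨T, hT⟩
    obtain ⟨v, hv, hvc, hvu⟩ := exists_iUnion_eq_closed_subset
      (u := fun i : T => (H i)ᶜ) (fun i => (hH i).isOpen_compl) (fun x => Set.toFinite _) (by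
        refine eq_univ_of_forall fun x => ?_
        by_contra hx
        have := ho x T (fun i hi => by
          by_contra hxi
          exact hx (mem_iUnion.2 ⟨⟨i, hi⟩, hxi⟩))
        omega)
    refine ⟨fun i => if h : i ∈ T then v ⟨i, h⟩ else ∅, fun i => ?_, fun i hi => ?_, fun x => ?_⟩
    · dsimp only
      split_ifs with h
      · exact hvc _
      · exact isClosed_empty
    · simp only [show i ∈ T from hi, dite_true]
      rw [← subset_compl_iff_disjoint_right]
      exact hvu ⟨i, hi⟩
    · obtain ⟨i, hi⟩ := mem_iUnion.1 (hv.ge (mem_univ x))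
      exact ⟨i, i.2, by simpa using hi⟩
  choose D hD1 hD2 hD3 using this
  refine ⟨fun i => U i ∩ ⋂ T : {T : {T : Finset (Fin k) // n + 1 < T.card} // i ∈ T.1}, (D T.1 i)ᶜ,
    fun i => ?_, fun i x hx => ⟨hHU i hx, ?_⟩, fun i => inter_subset_left, fun x T hT => ?_⟩
  · exact (hU i).inter (isOpen_iInter_of_finite fun T => (hD1 _ _).isOpen_compl)
  · refine mem_iInter.2 fun T hxD => ?_
    exact (hD2 T.1 i T.2).le_bot ⟨hxD, hx⟩
  · by_contra hlt
    obtain ⟨i, hi, hxi⟩ := hD3 ⟨T, not_le.1 hlt⟩ x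
    exact mem_iInter.1 (hT i hi).2 ⟨⟨T, not_le.1 hlt⟩, hi⟩ hxi

theorem RelDim.swell {Y : Type*} [TopologicalSpace Y] [NormalSpace Y] {S : Set Y} {n : ℕ}
    (h : RelDim S n) (hS : IsClosed S) {k : ℕ} (U : Fin k → Set Y) (hU : ∀ i, IsOpen (U i))
    (hcov : S ⊆ ⋃ i, U i) :
    ∃ G : Fin k → Set Y, (∀ i, IsOpen (G i)) ∧ (∀ i, G i ⊆ U i) ∧ S ⊆ ⋃ i, G i ∧
      ∀ x, ∀ T : Finset (Fin k), (∀ i ∈ T, x ∈ G i) → T.card ≤ n + 1 := by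
  obtain ⟨V, h1, h2, h3, h4⟩ := h k U hU hcov
  obtain ⟨v, hv, hvc, hvu⟩ := exists_subset_iUnion_closed_subset hS h1
    (fun x _ => Set.toFinite _) h3
  obtain ⟨G, g1, g2, g3, g4⟩ := exists_swelling (n := n) (fun i => v i ∩ S) U
    (fun i => (hvc i).inter hS) hU (fun i x hx => h2 i (hvu i hx.1)) (by
      intro x T hT
      rcases T.eq_empty_or_nonempty with rfl | ⟨i, hi⟩
      · simp
      · exact h4 x (hT i hi).2 T fun i hi => hvu i (hT i hi).1)
  refine ⟨G, g1, g3, fun x hx => ?_, g4⟩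
  obtain ⟨i, hi⟩ := mem_iUnion.1 (hv hx)
  exact mem_iUnion.2 ⟨i, g2 i ⟨hi, hx⟩⟩

/-- Dowker's theorem. -/
theorem relDim_dowker {Y : Type*} [TopologicalSpace Y] [NormalSpace Y] {X E : Set Y} {n : ℕ}
    (hX : IsClosed X) (hE : IsClosed E) (hdE : RelDim E n) (hEX : E ⊆ X)
    (hN : ∀ N : Set Y, IsClosed N → N ⊆ X → Disjoint N E → RelDim N n) : RelDim X n := by
  intro k U hU hcov
  obtain ⟨V, h1, h2, h3, h4⟩ := hdE.swell hE U hU (hEX.trans hcov)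
  obtain ⟨W, hW, hEW, hWV⟩ := normal_exists_closure_subset hE (isOpen_iUnion h1) h3
  obtain ⟨G, g1, g2, g3, g4⟩ := hN (X \ W) (hX.sdiff hW) sdiff_subset
    (disjoint_left.2 fun x hx hxE => hx.2 (hEW hxE)) k
    (fun i => (U i \ closure W) ∪ V i)
    (fun i => ((hU i).sdiff isClosed_closure).union (h1 i)) (by
      intro x hx
      by_cases hxW : x ∈ closure W
      · obtain ⟨i, hi⟩ := mem_iUnion.1 (hWV hxW)
        exact mem_iUnion.2 ⟨i, Or.inr hi⟩
      · obtain ⟨i, hi⟩ := mem_iUnion.1 (hcov hx.1)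
        exact mem_iUnion.2 ⟨i, Or.inl ⟨hi, hxW⟩⟩)
  have hGV : ∀ i x, x ∈ G i → x ∈ closure W → x ∈ V i := by
    intro i x hx hxW
    rcases g2 i hx with h | h
    · exact absurd hxW h.2
    · exact h
  refine ⟨fun i => (V i ∩ W) ∪ (G i \ closure W) ∪ (G i ∩ V i), fun i => ?_, ?_, ?_, ?_⟩
  · exact (((h1 i).inter hW).union ((g1 i).sdiff isClosed_closure)).union ((g1 i).inter (h1 i))
  · rintro i x ((hx | hx) | hx)
    · exact h2 i hx.1
    · rcases g2 i hx.1 with h | h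
      · exact h.1
      · exact h2 i h
    · exact h2 i hx.2
  · intro x hx
    by_cases hxW : x ∈ W
    · obtain ⟨i, hi⟩ := mem_iUnion.1 (hWV (subset_closure hxW))
      exact mem_iUnion.2 ⟨i, Or.inl (Or.inl ⟨hi, hxW⟩)⟩
    · obtain ⟨i, hi⟩ := mem_iUnion.1 (g3 ⟨hx, hxW⟩)
      refine mem_iUnion.2 ⟨i, ?_⟩
      by_cases hc : x ∈ closure W
      · exact Or.inr ⟨hi, hGV i x hi hc⟩
      · exact Or.inl (Or.inr ⟨hi, hc⟩)
  · intro x hx T hT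
    by_cases hxW : x ∈ W
    · refine h4 x T fun i hi => ?_
      rcases hT i hi with (h | h) | h
      · exact h.1
      · exact absurd (subset_closure hxW) h.2
      · exact h.2
    · refine g4 x ⟨hx, hxW⟩ T fun i hi => ?_
      rcases hT i hi with (h | h) | h
      · exact absurd h.2 hxW
      · exact h.1
      · exact h.1

theorem closure_inter_stoneCech {M : Type*} [TopologicalSpace M] [NormalSpace M]
    {A B : Set M} (hA : IsClosed A) (hB : IsClosed B) {y : StoneCech M}
    (hyA : y ∈ closure (stoneCechUnit '' A)) (hyB : y ∈ closure (stoneCechUnit '' B)) :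
    y ∈ closure ((stoneCechUnit : M → StoneCech M) '' (A ∩ B)) := by
  by_contra hy
  obtain ⟨N, hN, hNc, hNs⟩ := exists_mem_nhds_isClosed_subset
    (isClosed_closure.isOpen_compl.mem_nhds hy)
  have hj : Continuous (stoneCechUnit : M → StoneCech M) := continuous_stoneCechUnit
  have hd : Disjoint (A ∩ stoneCechUnit ⁻¹' N) (B ∩ stoneCechUnit ⁻¹' N) := by
    rw [disjoint_left]
    rintro x ⟨hxA, hxN⟩ ⟨hxB, -⟩
    exact hNs hxN (subset_closure ⟨x, ⟨hxA, hxB⟩, rfl⟩)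
  obtain ⟨f, hf0, hf1, hf⟩ := exists_continuous_zero_one_of_isClosed
    (hA.inter (hNc.preimage hj)) (hB.inter (hNc.preimage hj)) hd
  let f' : M → Icc (0 : ℝ) 1 := fun x => ⟨f x, hf x⟩
  have hf' : Continuous f' := by fun_prop
  have hcl : ∀ D : Set M, y ∈ closure (stoneCechUnit '' D) →
      y ∈ closure ((stoneCechUnit : M → StoneCech M) '' (D ∩ stoneCechUnit ⁻¹' N)) := by
    intro D hD
    rw [mem_closure_iff_nhds] at hD ⊢
    intro t ht
    obtain ⟨_, hz, x, hx, rfl⟩ := hD (t ∩ N) (Filter.inter_mem ht hN)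
    exact ⟨_, hz.1, x, ⟨hx, hz.2⟩, rfl⟩
  have e0 : stoneCechExtend hf' y = 0 := by
    have : closure ((stoneCechUnit : M → StoneCech M) '' (A ∩ stoneCechUnit ⁻¹' N)) ⊆
        {z | stoneCechExtend hf' z = 0} := by
      refine closure_minimal ?_ (isClosed_eq (continuous_stoneCechExtend hf') continuous_const)
      rintro _ ⟨x, hx, rfl⟩
      change stoneCechExtend hf' (stoneCechUnit x) = 0
      rw [stoneCechExtend_stoneCechUnit]
      exact Subtype.ext (hf0 hx)
    exact this (hcl A hyA)
  have e1 : stoneCechExtend hf' y = 1 := by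
    have : closure ((stoneCechUnit : M → StoneCech M) '' (B ∩ stoneCechUnit ⁻¹' N)) ⊆
        {z | stoneCechExtend hf' z = 1} := by
      refine closure_minimal ?_ (isClosed_eq (continuous_stoneCechExtend hf') continuous_const)
      rintro _ ⟨x, hx, rfl⟩
      change stoneCechExtend hf' (stoneCechUnit x) = 1
      rw [stoneCechExtend_stoneCechUnit]
      exact Subtype.ext (hf1 hx)
    exact this (hcl B hyB)
  rw [e0] at e1
  exact zero_ne_one e1

theorem closure_biInter_stoneCech {M : Type*} [TopologicalSpace M] [NormalSpace M] {ι : Type*}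
    (L : ι → Set M) (hL : ∀ i, IsClosed (L i)) {y : StoneCech M} (T : Finset ι)
    (hy : ∀ i ∈ T, y ∈ closure (stoneCechUnit '' L i)) :
    y ∈ closure ((stoneCechUnit : M → StoneCech M) '' (⋂ i ∈ T, L i)) := by
  classical
  induction T using Finset.induction_on with
  | empty =>
    simp only [Finset.notMem_empty, iInter_of_empty, iInter_univ, image_univ]
    exact denseRange_stoneCechUnit y
  | insert a T ha ih =>
    rw [Finset.set_biInter_insert]
    refine closure_inter_stoneCech (hL a) (isClosed_biInter fun i _ => hL i) (hy a (by simp)) ?_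
    exact ih fun i hi => hy i (by simp [hi])

theorem RelDim.stoneCech {M : Type*} [TopologicalSpace M] [NormalSpace M] {F : Set M}
    (hF : IsClosed F) {n : ℕ} (h : RelDim F n) :
    RelDim (closure ((stoneCechUnit : M → StoneCech M) '' F)) n := by
  intro k U hU hcov
  have hj : Continuous (stoneCechUnit : M → StoneCech M) := continuous_stoneCechUnit
  obtain ⟨U', hU'c, hU'o, hU'U⟩ := exists_subset_iUnion_closure_subset isClosed_closure hU
    (fun x _ => Set.toFinite _) hcov
  obtain ⟨V, h1, h2, h3, h4⟩ := h k (fun i => stoneCechUnit ⁻¹' U' i)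
    (fun i => (hU'o i).preimage hj) (by
      intro x hx
      obtain ⟨i, hi⟩ := mem_iUnion.1 (hU'c (subset_closure ⟨x, hx, rfl⟩))
      exact mem_iUnion.2 ⟨i, hi⟩)
  obtain ⟨v, hv, hvc, hvu⟩ := exists_subset_iUnion_closed_subset hF h1
    (fun x _ => Set.toFinite _) h3
  obtain ⟨G, g1, g2, g3, g4⟩ := exists_swelling (n := n)
    (fun i => closure ((stoneCechUnit : M → StoneCech M) '' (v i ∩ F))) U
    (fun i => isClosed_closure) hU (fun i => by
      refine (closure_mono ?_).trans (hU'U i)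
      rintro _ ⟨x, hx, rfl⟩
      exact h2 i (hvu i hx.1)) (by
      intro y T hT
      have hy := closure_biInter_stoneCech (fun i => v i ∩ F) (fun i => (hvc i).inter hF) T hT
      have hne : (⋂ i ∈ T, v i ∩ F).Nonempty := by
        by_contra hne
        rw [not_nonempty_iff_eq_empty] at hne
        simp only [hne, image_empty, closure_empty] at hy
        exact hy
      obtain ⟨x, hx⟩ := hne
      have hx' : ∀ i ∈ T, x ∈ v i ∩ F := fun i hi => mem_iInter₂.1 hx i hi
      rcases T.eq_empty_or_nonempty with rfl | ⟨i, hi⟩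
      · simp
      · exact h4 x (hx' i hi).2 T fun i hi => hvu i (hx' i hi).1)
  refine ⟨G, g1, g3, ?_, fun x _ => g4 x⟩
  have hcl : closure ((stoneCechUnit : M → StoneCech M) '' F) ⊆
      ⋃ i, closure ((stoneCechUnit : M → StoneCech M) '' (v i ∩ F)) := by
    refine closure_minimal ?_ (isClosed_iUnion_of_finite fun i => isClosed_closure)
    rintro _ ⟨x, hx, rfl⟩
    obtain ⟨i, hi⟩ := mem_iUnion.1 (hv hx)
    exact mem_iUnion.2 ⟨i, subset_closure ⟨x, ⟨hi, hx⟩, rfl⟩⟩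
  exact hcl.trans (iUnion_mono g2)

theorem RelDim.of_stoneCech {M : Type*} [TopologicalSpace M] [NormalSpace M] {F : Set M}
    (hF : IsClosed F) {n : ℕ}
    (h : RelDim (closure ((stoneCechUnit : M → StoneCech M) '' F)) n) : RelDim F n := by
  intro k U hU hcov
  have hj : Continuous (stoneCechUnit : M → StoneCech M) := continuous_stoneCechUnit
  have hcl : ∀ i, IsClosed (F \ U i) := fun i => hF.sdiff (hU i)
  obtain ⟨V, h1, h2, h3, h4⟩ := h k
    (fun i => (closure ((stoneCechUnit : M → StoneCech M) '' (F \ U i)))ᶜ)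
    (fun i => isClosed_closure.isOpen_compl) (by
      intro y hyF
      by_contra hy
      have hall : ∀ i, y ∈ closure ((stoneCechUnit : M → StoneCech M) '' (F \ U i)) := by
        intro i
        by_contra hyi
        exact hy (mem_iUnion.2 ⟨i, hyi⟩)
      have hcl' : IsClosed (⋂ i ∈ (Finset.univ : Finset (Fin k)), F \ U i) :=
        isClosed_biInter fun i _ => hcl i
      have := closure_inter_stoneCech hF hcl' hyF
        (closure_biInter_stoneCech (fun i => F \ U i) hcl Finset.univ fun i _ => hall i)
      have he : F ∩ (⋂ i ∈ (Finset.univ : Finset (Fin k)), F \ U i) = ∅ := by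
        rw [eq_empty_iff_forall_notMem]
        rintro x ⟨hxF, hx⟩
        obtain ⟨i, hi⟩ := mem_iUnion.1 (hcov hxF)
        exact (mem_iInter₂.1 hx i (Finset.mem_univ i)).2 hi
      rw [he] at this
      simp at this)
  refine ⟨fun i => stoneCechUnit ⁻¹' V i ∩ U i, fun i => ((h1 i).preimage hj).inter (hU i),
    fun i => inter_subset_right, fun x hx => ?_, fun x hx T hT => ?_⟩
  · obtain ⟨i, hi⟩ := mem_iUnion.1 (h3 (subset_closure ⟨x, hx, rfl⟩))
    refine mem_iUnion.2 ⟨i, hi, ?_⟩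
    by_contra hxU
    exact h2 i hi (subset_closure ⟨x, ⟨hx, hxU⟩, rfl⟩)
  · exact h4 _ (subset_closure ⟨x, hx, rfl⟩) T fun i hi => (hT i hi).1

/-- Open star of the lattice point `v` in the Kuhn triangulation: all of `0, x i - v i`
lie at distance `< 1` from each other. -/
def kuhnStar (m : ℕ) (v : Fin m → ℤ) : Set (Fin m → ℝ) :=
  {x | (∀ i, |x i - v i| < 1) ∧ ∀ i j, |(x i - v i) - (x j - v j)| < 1}

theorem isOpen_kuhnStar (m : ℕ) (v : Fin m → ℤ) : IsOpen (kuhnStar m v) := by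
  have : kuhnStar m v = (⋂ i, {x : Fin m → ℝ | |x i - v i| < 1}) ∩
      ⋂ i, ⋂ j, {x : Fin m → ℝ | |(x i - v i) - (x j - v j)| < 1} := by
    ext x; simp [kuhnStar]
  rw [this]
  refine (isOpen_iInter_of_finite fun i => ?_).inter
    (isOpen_iInter_of_finite fun i => isOpen_iInter_of_finite fun j => ?_)
  · exact isOpen_lt (by fun_prop) (by fun_prop)
  · exact isOpen_lt (by fun_prop) (by fun_prop)

theorem mem_kuhnStar_floor {m : ℕ} (x : Fin m → ℝ) : x ∈ kuhnStar m (fun i => ⌊x i⌋) := by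
  have h1 : ∀ i, 0 ≤ x i - ⌊x i⌋ := fun i => sub_nonneg.2 (Int.floor_le _)
  have h2 : ∀ i, x i - ⌊x i⌋ < 1 := fun i => by linarith [Int.lt_floor_add_one (x i)]
  refine ⟨fun i => ?_, fun i j => ?_⟩
  · rw [abs_lt]; constructor <;> linarith [h1 i, h2 i]
  · rw [abs_lt]; constructor <;> linarith [h1 i, h2 i, h1 j, h2 j]

/-- A point lies in at most `m + 1` open stars. -/
theorem kuhnStar_order {m : ℕ} (x : Fin m → ℝ) (T : Finset (Fin m → ℤ))
    (hT : ∀ v ∈ T, x ∈ kuhnStar m v) : T.card ≤ m + 1 := by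
  classical
  let w : (Fin m → ℤ) → Option (Fin m) → ℝ := fun v o => o.elim 0 (fun i => x i - v i)
  have hw : ∀ v ∈ T, ∀ o o', |w v o - w v o'| < 1 := by
    intro v hv o o'
    obtain ⟨h1, h2⟩ := hT v hv
    cases o <;> cases o' <;> simp only [w, Option.elim]
    · simp
    · rw [abs_sub_comm]; simpa using h1 _
    · simpa using h1 _
    · exact h2 _ _
  have hmin : ∀ v, ∃ o, ∀ o', w v o ≤ w v o' := fun v => Finite.exists_min (w v)
  choose g hg using hmin
  have hint : ∀ v v' o, ∃ z : ℤ, w v o - w v' o = z := by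
    intro v v' o
    cases o with
    | none => exact ⟨0, by simp [w]⟩
    | some i => exact ⟨v' i - v i, by simp [w]⟩
  have small : ∀ z : ℤ, |(z : ℝ)| < 1 → z = 0 := by
    intro z hz
    rw [← Int.cast_abs] at hz
    exact Int.abs_lt_one_iff.1 (by exact_mod_cast hz)
  have hinj : Set.InjOn g T := by
    intro v hv v' hv' hvv
    have hv : v ∈ T := hv
    have hv' : v' ∈ T := hv'
    have hmm : w v (g v) = w v' (g v) := by
      obtain ⟨z, hz⟩ := hint v v' (g v)
      have a1 := hg v none
      have a2 := hg v' none
      rw [← hvv] at a2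
      have b1 := abs_lt.1 (hw v hv (g v) none)
      have b2 := abs_lt.1 (hw v' hv' (g v) none)
      have c : ∀ u, w u none = 0 := fun u => rfl
      rw [c] at a1 a2 b1 b2
      have : z = 0 := small z (by rw [← hz, abs_lt]; constructor <;> linarith [b1.1, b2.1])
      rw [this] at hz
      simpa [sub_eq_zero] using hz
    funext i
    obtain ⟨z, hz⟩ := hint v v' (some i)
    have a1 := hg v (some i)
    have a2 := hg v' (some i)
    rw [← hvv] at a2
    have b1 := abs_lt.1 (hw v hv (g v) (some i))
    have b2 := abs_lt.1 (hw v' hv' (g v) (some i))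
    have : z = 0 := small z (by rw [← hz, abs_lt]; constructor <;> linarith [b1.1, b2.1])
    rw [this] at hz
    have hz' : (x i - v i) - (x i - v' i) = ((0 : ℤ) : ℝ) := hz
    have : (v i : ℝ) = v' i := by push_cast at hz'; linarith
    exact_mod_cast this
  have := Finset.card_le_card_of_injOn g (t := Finset.univ) (fun _ _ => Finset.mem_coe.2 (Finset.mem_univ _)) hinj
  simpa using this

theorem relDim_pi {m : ℕ} {K : Set (Fin m → ℝ)} (hK : IsCompact K) : RelDim K m := by
  classical
  intro k U hU hcov
  obtain ⟨δ, hδ, hleb⟩ := lebesgue_number_lemma_of_metric hK hU hcov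
  let s : ℝ := 2 / δ
  have hs : 0 < s := by positivity
  let sc : (Fin m → ℝ) → (Fin m → ℝ) := fun x i => s * x i
  have hsc : Continuous sc := by fun_prop
  let St : (Fin m → ℤ) → Set (Fin m → ℝ) := fun v => sc ⁻¹' kuhnStar m v
  have hball : ∀ v x y, x ∈ St v → y ∈ St v → y ∈ Metric.ball x δ := by
    intro v x y hx hy
    rw [Metric.mem_ball, dist_pi_lt_iff hδ]
    intro i
    have a := abs_lt.1 (hx.1 i)
    have b := abs_lt.1 (hy.1 i)
    have hd : |s * y i - s * x i| < 2 := by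
      rw [abs_lt]; constructor <;> linarith [a.1, a.2, b.1, b.2]
    rw [← mul_sub, abs_mul, abs_of_pos hs] at hd
    rw [Real.dist_eq]
    have : s * |y i - x i| < s * δ := by
      have : s * δ = 2 := by simp only [s]; field_simp
      rwa [this]
    exact lt_of_mul_lt_mul_left this hs.le
  have hch : ∀ v : {v // (St v ∩ K).Nonempty}, ∃ i, St v.1 ⊆ U i := by
    rintro ⟨v, x, hxv, hxK⟩
    obtain ⟨i, hi⟩ := hleb x hxK
    exact ⟨i, fun y hy => hi (hball v x y hxv hy)⟩
  choose g hg using hch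
  refine ⟨fun i => ⋃ v : {v : {v // (St v ∩ K).Nonempty} // g v = i}, St v.1.1, fun i => ?_,
    fun i => ?_, ?_, ?_⟩
  · exact isOpen_iUnion fun v => (isOpen_kuhnStar m _).preimage hsc
  · refine iUnion_subset ?_
    rintro ⟨v, rfl⟩
    exact hg v
  · intro x hx
    have hm : x ∈ St (fun i => ⌊sc x i⌋) := mem_kuhnStar_floor (sc x)
    exact mem_iUnion.2 ⟨g ⟨_, x, hm, hx⟩, mem_iUnion.2 ⟨⟨⟨_, x, hm, hx⟩, rfl⟩, hm⟩⟩
  · intro x _ T hT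
    have : ∀ i : T, ∃ v : {v // (St v ∩ K).Nonempty}, g v = i ∧ x ∈ St v.1 := by
      rintro ⟨i, hi⟩
      obtain ⟨⟨v, hv⟩, hx⟩ := mem_iUnion.1 (hT i hi)
      exact ⟨v, hv, hx⟩
    choose w hw hxw using this
    have hinj : Function.Injective (fun i : T => (w i).1) := by
      intro i j hij
      have : w i = w j := Subtype.ext hij
      apply Subtype.ext
      rw [← hw i, ← hw j, this]
    have := kuhnStar_order (sc x) (Finset.univ.image (fun i : T => (w i).1)) (by
      intro v hv
      obtain ⟨i, -, rfl⟩ := Finset.mem_image.1 hv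
      exact hxw i)
    rw [Finset.card_image_of_injective _ hinj] at this
    simpa using this

theorem isClosed_closure_diff_of_weaklyLocallyCompact {Y : Type*} [TopologicalSpace Y] [T2Space Y]
    (R : Set Y) [WeaklyLocallyCompactSpace R] : IsClosed (closure R \ R) := by
  rw [← isOpen_compl_iff, isOpen_iff_mem_nhds]
  intro x hx
  by_cases hxR : x ∈ R
  · obtain ⟨N, hN, hxN⟩ := exists_compact_mem_nhds (⟨x, hxR⟩ : R)
    have hNc : IsClosed (((↑) : R → Y) '' N) := (hN.image continuous_subtype_val).isClosed
    rw [nhds_subtype_eq_comap, Filter.mem_comap] at hxN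
    obtain ⟨t, ht, htN⟩ := hxN
    obtain ⟨O, hOt, hO, hxO⟩ := mem_nhds_iff.1 ht
    refine Filter.mem_of_superset (hO.mem_nhds hxO) ?_
    rintro y hyO ⟨hycl, hyR⟩
    have h1 : y ∈ closure (O ∩ R) := hO.inter_closure ⟨hyO, hycl⟩
    have h2 : closure (O ∩ R) ⊆ ((↑) : R → Y) '' N := by
      refine closure_minimal ?_ hNc
      rintro z ⟨hzO, hzR⟩
      exact ⟨⟨z, hzR⟩, htN (hOt hzO), rfl⟩
    obtain ⟨z, -, rfl⟩ := h2 h1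
    exact hyR z.2
  · have : x ∉ closure R := fun h => hx ⟨h, hxR⟩
    refine Filter.mem_of_superset (isClosed_closure.isOpen_compl.mem_nhds this) ?_
    exact fun y hy hy' => hy hy'.1

theorem weaklyLocallyCompact_sum {A B : Type*} [TopologicalSpace A] [TopologicalSpace B]
    [WeaklyLocallyCompactSpace A] [WeaklyLocallyCompactSpace B] :
    WeaklyLocallyCompactSpace (A ⊕ B) := by
  constructor
  rintro (a | b)
  · obtain ⟨N, hN, h⟩ := exists_compact_mem_nhds a
    exact ⟨Sum.inl '' N, hN.image continuous_inl, IsOpenEmbedding.inl.image_mem_nhds.2 h⟩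
  · obtain ⟨N, hN, h⟩ := exists_compact_mem_nhds b
    exact ⟨Sum.inr '' N, hN.image continuous_inr, IsOpenEmbedding.inr.image_mem_nhds.2 h⟩

/-- Compact subsets of an embedded copy of `Z` inherit bounds on dimension from `Z`. -/
theorem relDim_of_subset_range {Z Y : Type*} [TopologicalSpace Z] [TopologicalSpace Y]
    {f : Z → Y} (hf : IsEmbedding f) {n : ℕ} (hZ : ∀ K : Set Z, IsCompact K → RelDim K n)
    {N : Set Y} (hN : IsCompact N) (hr : N ⊆ range f) : RelDim N n := by
  rw [← image_preimage_eq_of_subset hr, relDim_image_iff hf.isInducing]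
  apply hZ
  rw [hf.isInducing.isCompact_iff, image_preimage_eq_of_subset hr]
  exact hN

/-- If a normal countably compact space `M` has Stone–Čech remainder homeomorphic to the
disjoint sum of a Henderson compactum `C` (infinite dimensional, with every compact
subset either zero-dimensional or infinite-dimensional) and an open subset of `S³`, and
every compact subset of `M` has dimension `≤ 4`, then every closed `F ⊆ M` satisfies
`dim F ≤ 4` or `dim F = ∞`. -/
theorem closed_subset_dim_dichotomy (M : Type u) [TopologicalSpace M] [NormalSpace M]
    [T35Space M] (hM : CountablyCompact M)
    (C : Type u) [TopologicalSpace C] [CompactSpace C]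
    [TopologicalSpace.MetrizableSpace C]
    (U : Set (Metric.sphere (0 : EuclideanSpace ℝ (Fin 4)) 1)) (hU : IsOpen U)
    (hrem : Nonempty (↥(StoneCechRemainder M) ≃ₜ (C ⊕ ↥U)))
    (hCinf : covDim C = ⊤)
    (hHend : ∀ K : Set C, IsCompact K → covDim ↥K = 0 ∨ covDim ↥K = ⊤)
    (hcmp : ∀ K : Set M, IsCompact K → covDim ↥K ≤ (4 : ℕ∞)) :
    ∀ F : Set M, IsClosed F → covDim ↥F ≤ (4 : ℕ∞) ∨ covDim ↥F = ⊤ := by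
  intro F hF
  by_cases htop : covDim ↥F = ⊤
  · exact Or.inr htop
  left
  obtain ⟨e⟩ := hrem
  set j : M → StoneCech M := stoneCechUnit with hj_def
  have hj : IsEmbedding j := isEmbedding_stoneCechUnit
  have : NormalSpace ↥F := hF.isClosedEmbedding_subtypeVal.normalSpace
  obtain ⟨n, -, hn⟩ := exists_of_covDim_ne_top htop
  rw [covDimLE_iff] at hn
  have hMcomp : ∀ K : Set M, IsCompact K → RelDim K 4 := by
    intro K hK
    have := isCompact_iff_compactSpace.1 hK
    exact (covDim_le_iff K 4).1 (hcmp K hK)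
  set B := closure (j '' F) with hB
  have hBn : RelDim B n := hn.stoneCech hF
  have hBc : IsClosed B := isClosed_closure
  set R := StoneCechRemainder M with hR
  have hRj : ∀ y, y ∉ R → y ∈ range j := fun y hy => not_not.1 hy
  let c : C → StoneCech M := fun z => (e.symm (Sum.inl z) : StoneCech M)
  have hc : IsEmbedding c :=
    IsEmbedding.subtypeVal.comp (e.symm.isEmbedding.comp IsEmbedding.inl)
  let u : ↥U → StoneCech M := fun z => (e.symm (Sum.inr z) : StoneCech M)
  have hu : IsEmbedding u :=
    IsEmbedding.subtypeVal.comp (e.symm.isEmbedding.comp IsEmbedding.inr)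
  have hRcu : ∀ y ∈ R, y ∈ range c ∨ y ∈ range u := by
    intro y hy
    rcases h : e ⟨y, hy⟩ with z | z
    · left; exact ⟨z, by simp [c, ← h]⟩
    · right; exact ⟨z, by simp [u, ← h]⟩
  have hcB : RelDim (B ∩ range c) 4 := by
    have hcl : IsClosed (range c) := (isCompact_range hc.continuous).isClosed
    have h1 : RelDim (B ∩ range c) n := hBn.mono (hBc.inter hcl) inter_subset_left
    rw [← image_preimage_eq_inter_range, relDim_image_iff hc.isInducing] at h1 ⊢
    have hK : IsCompact (c ⁻¹' B) := (hBc.preimage hc.continuous).isCompact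
    have := isCompact_iff_compactSpace.1 hK
    rw [← covDim_le_iff] at h1 ⊢
    rcases hHend _ hK with h | h
    · rw [h]; exact zero_le
    · rw [h] at h1; simp at h1
  have hUdim : ∀ K : Set ↥U, IsCompact K → RelDim K 4 := by
    intro K hK
    let q : ↥U → (Fin 4 → ℝ) := fun z =>
      EuclideanSpace.equiv (Fin 4) ℝ ((z : Metric.sphere (0 : EuclideanSpace ℝ (Fin 4)) 1) :
        EuclideanSpace ℝ (Fin 4))
    have hq : IsEmbedding q :=
      (EuclideanSpace.equiv (Fin 4) ℝ).toHomeomorph.isEmbedding.comp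
        (IsEmbedding.subtypeVal.comp IsEmbedding.subtypeVal)
    rw [← relDim_image_iff hq.isInducing]
    exact relDim_pi (hK.image hq.continuous)
  have hRclosed : IsClosed (closure R \ R) := by
    have : LocallyCompactSpace ↥U := hU.locallyCompactSpace
    have := weaklyLocallyCompact_sum (A := C) (B := ↥U)
    have : WeaklyLocallyCompactSpace ↥R := e.isClosedEmbedding.weaklyLocallyCompactSpace
    exact isClosed_closure_diff_of_weaklyLocallyCompact R
  have hccl : IsClosed (B ∩ range c) := hBc.inter (isCompact_range hc.continuous).isClosed
  have hEcl : IsClosed (B ∩ (closure R \ R)) := hBc.inter hRclosed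
  have s1 : RelDim (B ∩ range c ∪ B ∩ (closure R \ R)) 4 := by
    refine relDim_dowker (hccl.union hEcl) hccl hcB subset_union_left ?_
    intro N hN hNs hNd
    refine relDim_of_subset_range hj hMcomp hN.isCompact fun y hy => ?_
    rcases hNs hy with h | h
    · exact absurd h (disjoint_left.1 hNd hy)
    · exact hRj y h.2.2
  have s2 : RelDim (B ∩ closure R) 4 := by
    refine relDim_dowker (hBc.inter isClosed_closure) (hccl.union hEcl) s1 ?_ ?_
    · rintro y (⟨hy, z, rfl⟩ | h)
      · exact ⟨hy, subset_closure (e.symm (Sum.inl z)).2⟩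
      · exact ⟨h.1, h.2.1⟩
    · intro N hN hNs hNd
      refine relDim_of_subset_range hu hUdim hN.isCompact fun y hy => ?_
      have hyB := hNs hy
      have hnot := disjoint_left.1 hNd hy
      by_cases hyR : y ∈ R
      · rcases hRcu y hyR with h | h
        · exact absurd (Or.inl ⟨hyB.1, h⟩) hnot
        · exact h
      · exact absurd (Or.inr ⟨hyB.1, hyB.2, hyR⟩) hnot
  have s3 : RelDim B 4 := by
    refine relDim_dowker hBc (hBc.inter isClosed_closure) s2 inter_subset_left ?_
    intro N hN hNs hNd
    refine relDim_of_subset_range hj hMcomp hN.isCompact fun y hy => hRj y fun hyR => ?_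
    exact disjoint_left.1 hNd hy ⟨hNs hy, subset_closure hyR⟩
  exact (covDim_le_iff F 4).2 (RelDim.of_stoneCech hF s3)
end

section
/- Suppose a normal space X is the union of countably many closed countably compact subsets X_i (i ∈ ℕ), and L is a countable simplicial complex with L ∈ AE(X_i) for each i. Then L ∈ AE(X). -/
open Set Topology

universe u v w

theorem aux_tendsto_tsum {ι X : Type*} {l : Filter X} {q P : X → ι → ℝ} {q0 P0 : ι → ℝ}
    (hq0 : ∀ x n, 0 ≤ q x n) (hqP : ∀ x n, q x n ≤ P x n)
    (hq00 : ∀ n, 0 ≤ q0 n) (hqP0 : ∀ n, q0 n ≤ P0 n)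
    (hq : ∀ n, Filter.Tendsto (fun x => q x n) l (𝓝 (q0 n)))
    (hP : ∀ n, Filter.Tendsto (fun x => P x n) l (𝓝 (P0 n)))
    (hs : ∀ x, Summable (P x)) (hs0 : Summable P0)
    (hsum : Filter.Tendsto (fun x => ∑' n, P x n) l (𝓝 (∑' n, P0 n))) :
    Filter.Tendsto (fun x => ∑' n, q x n) l (𝓝 (∑' n, q0 n)) := by
  have hsq : ∀ x, Summable (q x) := fun x => (hs x).of_nonneg_of_le (hq0 x) (hqP x)
  have hsq0 : Summable q0 := hs0.of_nonneg_of_le hq00 hqP0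
  have key : ∀ (a b : ι → ℝ) (_ : Summable a) (_ : Summable b) (_ : ∀ n, 0 ≤ a n)
      (_ : ∀ n, a n ≤ b n) (s : Finset ι),
      ∑ n ∈ s, a n ≤ ∑' n, a n ∧ ∑' n, a n - ∑ n ∈ s, a n ≤ ∑' n, b n - ∑ n ∈ s, b n := by
    intro a b ha hb h0 hab s
    refine ⟨ha.sum_le_tsum s (fun i _ => h0 i), ?_⟩
    have h := (hb.sub ha).sum_le_tsum s (fun i _ => sub_nonneg.2 (hab i))
    rw [hb.tsum_sub ha, Finset.sum_sub_distrib] at h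
    linarith
  rw [Metric.tendsto_nhds]
  intro ε hε
  obtain ⟨s, hsε⟩ := ((hs0.hasSum.eventually (lt_mem_nhds
    (show ∑' n, P0 n - ε / 6 < ∑' n, P0 n by linarith)))).exists
  have e1 : ∀ᶠ x in l, ∑' n, P0 n - ε / 6 < ∑ n ∈ s, P x n :=
    (tendsto_finsetSum s (fun n _ => hP n)).eventually (lt_mem_nhds hsε)
  have e2 : ∀ᶠ x in l, ∑' n, P x n < ∑' n, P0 n + ε / 6 :=
    hsum.eventually (gt_mem_nhds (by linarith))
  have e3 := Metric.tendsto_nhds.1 (tendsto_finsetSum s (fun n _ => hq n)) (ε / 6) (by linarith)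
  filter_upwards [e1, e2, e3] with x h1 h2 h3
  rw [Real.dist_eq, abs_lt] at h3 ⊢
  have k1 := key _ _ (hsq x) (hs x) (hq0 x) (hqP x) s
  have k2 := key _ _ hsq0 hs0 hq00 hqP0 s
  constructor <;> linarith [h3.1, h3.2, k1.1, k1.2, k2.1, k2.2]

/-- Pointwise model of the realization of a family of finite subsets of `ℕ`. -/
def AuxK (F : Set (Finset ℕ)) : Set (ℕ → ℝ) :=
  {p | ∃ s ∈ F, (∀ n, p n ≠ 0 → n ∈ s) ∧ (∀ n, 0 ≤ p n) ∧ ∑ n ∈ s, p n = 1}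

theorem AuxK.hasSum {F : Set (Finset ℕ)} {p : ℕ → ℝ} (hp : p ∈ AuxK F) : HasSum p 1 := by
  obtain ⟨s, -, h1, -, h3⟩ := hp
  rw [← h3]
  exact hasSum_sum_of_ne_finset_zero (fun b hb => by
    by_contra h
    exact hb (h1 b h))

/-- Threshold set. -/
def AuxT (F : Set (Finset ℕ)) (p : ℕ → ℝ) : Set ℝ :=
  {t | t = 0 ∨ ∃ s : Finset ℕ, s.Nonempty ∧ s ∉ F ∧ ∀ n ∈ s, t ≤ p n}

theorem AuxT.bdd (F : Set (Finset ℕ)) {p : ℕ → ℝ} (h0 : ∀ n, 0 ≤ p n) (hp : HasSum p 1) :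
    BddAbove (AuxT F p) := by
  refine ⟨1, ?_⟩
  rintro t (rfl | ⟨s, ⟨n, hn⟩, -, h⟩)
  · norm_num
  · exact (h n hn).trans (le_hasSum hp n (fun j _ => h0 j))

theorem AuxT.nonneg (F : Set (Finset ℕ)) {p : ℕ → ℝ} (h0 : ∀ n, 0 ≤ p n) (hp : HasSum p 1) :
    0 ≤ sSup (AuxT F p) := le_csSup (AuxT.bdd F h0 hp) (Or.inl rfl)

theorem AuxT.le_add (F : Set (Finset ℕ)) {p p' : ℕ → ℝ} (h0 : ∀ n, 0 ≤ p n) (hp : HasSum p 1)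
    {δ : ℝ} (hδ0 : 0 ≤ δ) (hδ : ∀ n, p' n ≤ p n + δ) :
    sSup (AuxT F p') ≤ sSup (AuxT F p) + δ := by
  refine csSup_le ⟨0, Or.inl rfl⟩ ?_
  rintro t (rfl | ⟨s, hs, hF, h⟩)
  · linarith [AuxT.nonneg F h0 hp]
  · have : t - δ ≤ sSup (AuxT F p) := le_csSup (AuxT.bdd F h0 hp)
      (Or.inr ⟨s, hs, hF, fun n hn => by linarith [h n hn, hδ n]⟩)
    linarith

theorem AuxT.eq_zero {F : Set (Finset ℕ)} (hF : ∀ s ∈ F, ∀ t, t ⊆ s → t.Nonempty → t ∈ F)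
    {p : ℕ → ℝ} (hp : p ∈ AuxK F) : sSup (AuxT F p) = 0 := by
  have hsum := AuxK.hasSum hp
  obtain ⟨s, hs, h1, h2, h3⟩ := hp
  refine le_antisymm (csSup_le ⟨0, Or.inl rfl⟩ ?_) (AuxT.nonneg F h2 hsum)
  rintro t (rfl | ⟨u, hu, huF, h⟩)
  · exact le_rfl
  · by_contra! ht
    exact huF (hF s hs u (fun n hn => h1 n (by linarith [h n hn])) hu)

/-- Retraction onto the complex, on a space mapping continuously to finitely supported
probability vectors. -/
theorem aux_retract {X : Type*} [TopologicalSpace X] {F : Set (Finset ℕ)}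
    (hF : ∀ s ∈ F, ∀ t, t ⊆ s → t.Nonempty → t ∈ F)
    (P : X → ℕ → ℝ) (hP : Continuous P) (h0 : ∀ x n, 0 ≤ P x n) (h1 : ∀ x, HasSum (P x) 1)
    (hfin : ∀ x, (Function.support (P x)).Finite) :
    ∃ (U : Set X) (G : X → ℕ → ℝ), IsOpen U ∧ ContinuousOn G U ∧ (∀ x ∈ U, G x ∈ AuxK F) ∧
      ∀ x, P x ∈ AuxK F → x ∈ U ∧ G x = P x := by
  have hPn : ∀ n, Continuous (fun x => P x n) := fun n => (continuous_apply n).comp hP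
  have hdist : ∀ x0, Filter.Tendsto (fun x => ∑' n, |P x n - P x0 n|) (𝓝 x0) (𝓝 0) := by
    intro x0
    have := aux_tendsto_tsum (l := 𝓝 x0) (q := fun x n => |P x n - P x0 n|)
      (P := fun x n => P x n + P x0 n) (q0 := fun _ => 0) (P0 := fun n => P x0 n + P x0 n)
      (fun _ _ => abs_nonneg _)
      (fun x n => by rw [abs_le]; constructor <;> linarith [h0 x n, h0 x0 n])
      (fun _ => le_rfl) (fun n => by linarith [h0 x0 n])
      (fun n => by
        have : Continuous (fun x => |P x n - P x0 n|) := by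
          have := hPn n
          fun_prop
        simpa using this.tendsto x0)
      (fun n => ((hPn n).add continuous_const).tendsto x0)
      (fun x => (h1 x).summable.add (h1 x0).summable) ((h1 x0).summable.add (h1 x0).summable)
      (by
        have : ∀ x, ∑' n, (P x n + P x0 n) = 1 + 1 := fun x => ((h1 x).add (h1 x0)).tsum_eq
        simp only [this]
        exact tendsto_const_nhds)
    simpa using this
  have hsummable : ∀ x x0, Summable (fun n => |P x n - P x0 n|) := fun x x0 =>
    ((h1 x).summable.sub (h1 x0).summable).abs
  set τ : X → ℝ := fun x => sSup (AuxT F (P x)) with hτ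
  have hτ0 : ∀ x, 0 ≤ τ x := fun x => AuxT.nonneg F (h0 x) (h1 x)
  have hτc : Continuous τ := by
    rw [continuous_iff_continuousAt]
    intro x0
    rw [ContinuousAt, tendsto_iff_dist_tendsto_zero]
    refine squeeze_zero (fun _ => dist_nonneg) (fun x => ?_) (hdist x0)
    have hle : ∀ n, |P x n - P x0 n| ≤ ∑' n, |P x n - P x0 n| := fun n =>
      (hsummable x x0).le_tsum n (fun j _ => abs_nonneg _)
    have hnn : 0 ≤ ∑' n, |P x n - P x0 n| := tsum_nonneg (fun _ => abs_nonneg _)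
    have a := AuxT.le_add F (h0 x0) (h1 x0) hnn
      (fun n => by linarith [(abs_le.1 (hle n)).2] : ∀ n, P x n ≤ P x0 n + _)
    have b := AuxT.le_add F (h0 x) (h1 x) hnn
      (fun n => by linarith [(abs_le.1 (hle n)).1] : ∀ n, P x0 n ≤ P x n + _)
    rw [Real.dist_eq, abs_le]
    constructor <;> simp only [hτ] <;> linarith
  set q : X → ℕ → ℝ := fun x n => max (P x n - τ x) 0 with hq
  have hq0 : ∀ x n, 0 ≤ q x n := fun x n => le_max_right _ _
  have hqP : ∀ x n, q x n ≤ P x n := fun x n => max_le (by linarith [hτ0 x]) (h0 x n)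
  have hqc : ∀ n, Continuous (fun x => q x n) := fun n => by
    have := hPn n
    simp only [hq]
    fun_prop
  have hqs : ∀ x, Summable (q x) := fun x => (h1 x).summable.of_nonneg_of_le (hq0 x) (hqP x)
  have hσ : Continuous (fun x => ∑' n, q x n) := by
    rw [continuous_iff_continuousAt]
    intro x0
    refine aux_tendsto_tsum (P := P) (P0 := P x0) hq0 hqP (hq0 x0) (hqP x0)
      (fun n => (hqc n).tendsto x0) (fun n => (hPn n).tendsto x0) (fun x => (h1 x).summable)
      (h1 x0).summable ?_
    simp only [(h1 _).tsum_eq]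
    exact tendsto_const_nhds
  refine ⟨{x | 0 < ∑' n, q x n}, fun x n => q x n / ∑' n, q x n,
    isOpen_lt continuous_const hσ, ?_, ?_, ?_⟩
  · refine continuousOn_pi.2 fun n => ?_
    exact (hqc n).continuousOn.div hσ.continuousOn (fun x hx => ne_of_gt hx)
  · intro x hx
    have hx' : 0 < ∑' n, q x n := hx
    have hsf : (Function.support (q x)).Finite := (hfin x).subset (fun n hn => by
      have h1 : q x n ≠ 0 := hn
      have h2 := hqP x n
      have h3 := lt_of_le_of_ne (hq0 x n) (Ne.symm h1)
      exact ne_of_gt (h3.trans_le h2))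
    have hmem : ∀ n, n ∈ hsf.toFinset ↔ τ x < P x n := by
      intro n
      simp [hq, Function.mem_support]
    have hts : ∑' n, q x n = ∑ n ∈ hsf.toFinset, q x n :=
      tsum_eq_sum (fun n hn => by simpa using hn)
    have hne : hsf.toFinset.Nonempty := by
      by_contra h
      rw [Finset.not_nonempty_iff_eq_empty] at h
      rw [hts, h] at hx'
      simp at hx'
    refine ⟨hsf.toFinset, ?_, ?_, ?_, ?_⟩
    · by_contra hnF
      obtain ⟨m, hm, hmin⟩ := hsf.toFinset.exists_min_image (P x) hne
      have : P x m ≤ τ x := le_csSup (AuxT.bdd F (h0 x) (h1 x))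
        (Or.inr ⟨_, hne, hnF, hmin⟩)
      linarith [(hmem m).1 hm]
    · intro n hn
      simp only [ne_eq, div_eq_zero_iff, not_or] at hn
      simpa using hn.1
    · intro n
      exact div_nonneg (hq0 x n) hx'.le
    · rw [← Finset.sum_div, ← hts]
      exact div_self hx'.ne'
  · intro x hx
    have hz : τ x = 0 := AuxT.eq_zero hF hx
    have hqx : q x = P x := by
      funext n
      simp [hq, hz, h0 x n]
    have hs : ∑' n, q x n = 1 := by rw [hqx]; exact (h1 x).tsum_eq
    refine ⟨by simp [hs], ?_⟩
    funext n
    simp only [hqx, (h1 x).tsum_eq, div_one]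

/-- A nonnegative function vanishing on `Y` whose zero set is mapped into the image of `Y`. -/
theorem aux_zero {X : Type*} [TopologicalSpace X] [NormalSpace X] (A : ℕ → Set X)
    (hA : ∀ i, IsClosed (A i)) (hcc : ∀ i, CountablyCompact ↥(A i)) (hcov : ⋃ i, A i = univ)
    {Y : Set X} (hY : IsClosed Y) (Φ : X → ℕ → ℝ) (hΦ : Continuous Φ) :
    ∃ g : X → ℝ, Continuous g ∧ (∀ x, 0 ≤ g x) ∧ (∀ y ∈ Y, g y = 0) ∧
      ∀ x, g x = 0 → Φ x ∈ Φ '' Y := by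
  have hAc : ∀ i, IsCountablyCompact (A i) := by
    intro i
    rw [isCountablyCompact_iff_isCountablyCompact_univ, isCountablyCompact_iff_countable_open_cover]
    intro U hU hsub
    obtain ⟨t, ht⟩ := hcc i U hU (univ_subset_iff.1 hsub)
    exact ⟨t, ht.symm.subset⟩
  have hC : ∀ i, IsClosed (Φ '' (Y ∩ A i)) := by
    intro i
    have h1 : IsCountablyCompact (Y ∩ A i) :=
      (hAc i).of_isClosed_subset (hY.inter (hA i)) inter_subset_right
    exact (h1.image hΦ).isCompact.isClosed
  have hD : ∀ i, ∃ D : ℕ → Set (ℕ → ℝ), (∀ n, IsClosed (D n)) ∧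
      ⋃ n, D n = (Φ '' (Y ∩ A i))ᶜ := by
    intro i
    let _ := TopologicalSpace.metrizableSpaceMetric (ℕ → ℝ)
    obtain ⟨D, h1, -, h2, -⟩ := (hC i).isOpen_compl.exists_iUnion_isClosed
    exact ⟨D, h1, h2⟩
  choose D hDc hDu using hD
  have hg : ∀ n : ℕ, ∃ g : C(X, ℝ), EqOn g 0 Y ∧
      EqOn g 1 (A n.unpair.1 ∩ Φ ⁻¹' (D n.unpair.1 n.unpair.2)) ∧ ∀ x, g x ∈ Icc (0 : ℝ) 1 := by
    intro n
    refine exists_continuous_zero_one_of_isClosed hY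
      ((hA _).inter ((hDc _ _).preimage hΦ)) ?_
    rw [Set.disjoint_left]
    rintro x hxY ⟨hxA, hxD⟩
    have : Φ x ∈ (Φ '' (Y ∩ A n.unpair.1))ᶜ := by
      rw [← hDu]
      exact mem_iUnion.2 ⟨_, hxD⟩
    exact this ⟨x, ⟨hxY, hxA⟩, rfl⟩
  choose g hg0 hg1 hg01 using hg
  have hb : ∀ n x, ‖(1 / 2 : ℝ) ^ n * g n x‖ ≤ (1 / 2 : ℝ) ^ n := by
    intro n x
    rw [Real.norm_of_nonneg (mul_nonneg (by positivity) (hg01 n x).1)]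
    exact mul_le_of_le_one_right (by positivity) (hg01 n x).2
  have hs : ∀ x, Summable (fun n => (1 / 2 : ℝ) ^ n * g n x) := fun x =>
    Summable.of_norm_bounded summable_geometric_two (fun n => hb n x)
  have hnn : ∀ x n, 0 ≤ (1 / 2 : ℝ) ^ n * g n x := fun x n =>
    mul_nonneg (by positivity) (hg01 n x).1
  refine ⟨fun x => ∑' n, (1 / 2 : ℝ) ^ n * g n x,
    continuous_tsum (fun n => by fun_prop) summable_geometric_two hb,
    fun x => tsum_nonneg (hnn x), ?_, ?_⟩
  · intro y hy
    have : ∀ n, g n y = 0 := fun n => hg0 n hy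
    simp [this]
  · intro x hx
    have hz : ∀ n, g n x = 0 := by
      intro n
      have h1 := (hs x).le_tsum n (fun j _ => hnn x j)
      have hx' : ∑' n, (1 / 2 : ℝ) ^ n * g n x = 0 := hx
      rw [hx'] at h1
      have h2 := le_antisymm h1 (hnn x n)
      rcases mul_eq_zero.1 h2 with h | h
      · exact absurd h (by positivity)
      · exact h
    by_contra hxY
    obtain ⟨i, hi⟩ := mem_iUnion.1 (hcov.symm.subset (mem_univ x))
    have : Φ x ∈ ⋃ n, D i n := by
      rw [hDu]
      rintro ⟨y, hy, hyx⟩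
      exact hxY ⟨y, hy.1, hyx⟩
    obtain ⟨k, hk⟩ := mem_iUnion.1 this
    have h1 := hg1 (Nat.pair i k) (show x ∈ _ by simpa using And.intro hi hk)
    rw [hz] at h1
    simp at h1

theorem aux_ane {X : Type*} [TopologicalSpace X] [NormalSpace X] (A : ℕ → Set X)
    (hA : ∀ i, IsClosed (A i)) (hcc : ∀ i, CountablyCompact ↥(A i)) (hcov : ⋃ i, A i = univ)
    {F : Set (Finset ℕ)} (hF : ∀ s ∈ F, ∀ t, t ⊆ s → t.Nonempty → t ∈ F)
    {Y : Set X} (hY : IsClosed Y) (f : X → ℕ → ℝ) (hf : ContinuousOn f Y)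
    (hfK : ∀ y ∈ Y, f y ∈ AuxK F) :
    ∃ (U : Set X) (G : X → ℕ → ℝ), IsOpen U ∧ Y ⊆ U ∧ ContinuousOn G U ∧
      (∀ x ∈ U, G x ∈ AuxK F) ∧ EqOn G f Y := by
  obtain ⟨E, hE⟩ := ContinuousMap.exists_restrict_eq hY
    (⟨Y.domRestrict f, continuousOn_iff_continuous_domRestrict.1 hf⟩ : C(Y, ℕ → ℝ))
  have hEf : ∀ y ∈ Y, E y = f y := fun y hy => congrArg (fun h => h ⟨y, hy⟩) hE
  have hEn : ∀ n, Continuous (fun x => E x n) := fun n => (continuous_apply n).comp E.continuous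
  set T : ℕ → X → ℝ := fun n x => min 1 (∑ k ∈ Finset.range n, |E x k|) with hT
  have hTc : ∀ n, Continuous (T n) := fun n =>
    continuous_const.min (continuous_finsetSum _ (fun k _ => (hEn k).abs))
  have hTm : ∀ n x, T n x ≤ T (n + 1) x := fun n x =>
    min_le_min le_rfl (by rw [Finset.sum_range_succ]; linarith [abs_nonneg (E x n)])
  have hTY : ∀ n, ∀ y ∈ Y, T n y = ∑ k ∈ Finset.range n, f y k := by
    intro n y hy
    obtain ⟨s, hs, h1, h2, h3⟩ := hfK y hy
    simp only [hT, hEf y hy, abs_of_nonneg (h2 _)]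
    exact min_eq_right (sum_le_hasSum _ (fun i _ => h2 i) (AuxK.hasSum (hfK y hy)))
  obtain ⟨g, hgc, hg0, hgY, hgz⟩ := aux_zero A hA hcc hcov hY
    (fun x n => T (n + 1) x - T n x) (continuous_pi fun n => (hTc _).sub (hTc _))
  have hΦY : ∀ y ∈ Y, (fun n => T (n + 1) y - T n y) = f y := by
    intro y hy
    funext n
    rw [hTY _ y hy, hTY _ y hy, Finset.sum_range_succ]
    ring
  set S : ℕ → X → ℝ := fun n x => max (T n x) (min 1 (n * g x)) with hS
  have hSc : ∀ n, Continuous (S n) := fun n => by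
    have := hTc n
    simp only [hS]
    fun_prop
  have hSm : ∀ n x, S n x ≤ S (n + 1) x := fun n x =>
    max_le_max (hTm n x) (min_le_min le_rfl (by push_cast; nlinarith [hg0 x]))
  have hS0 : ∀ x, S 0 x = 0 := fun x => by simp [hS, hT]
  have hTnn : ∀ n x, 0 ≤ T n x := fun n x =>
    le_min zero_le_one (Finset.sum_nonneg fun _ _ => abs_nonneg _)
  have hST : ∀ n x, g x = 0 → S n x = T n x := fun n x hx => by
    simp [hS, hx, hTnn n x]
  have hPz : ∀ x, g x = 0 → (fun n => S (n + 1) x - S n x) ∈ AuxK F := by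
    intro x hx
    simp only [hST _ x hx]
    obtain ⟨y, hy, hyx⟩ := hgz x hx
    have hyx' : (fun n => T (n + 1) y - T n y) = fun n => T (n + 1) x - T n x := hyx
    rw [← hyx', hΦY y hy]
    exact hfK y hy
  have hSone : ∀ x, 0 < g x → ∃ N : ℕ, ∀ n, N ≤ n → S n x = 1 := by
    intro x hx
    obtain ⟨N, hN⟩ := exists_nat_gt (1 / g x)
    refine ⟨N, fun n hn => ?_⟩
    have h1 : 1 ≤ n * g x := by
      rw [div_lt_iff₀ hx] at hN
      have : (N : ℝ) ≤ n := by exact_mod_cast hn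
      nlinarith
    have h2 : T n x ≤ 1 := min_le_left _ _
    simp [hS, h1, h2]
  obtain ⟨U, G, hU, hG, hGK, hGP⟩ := aux_retract hF (fun x n => S (n + 1) x - S n x)
    (continuous_pi fun n => (hSc _).sub (hSc _)) (fun x n => sub_nonneg.2 (hSm n x))
    (by
      intro x
      rcases (hg0 x).eq_or_lt with h | h
      · exact AuxK.hasSum (hPz x h.symm)
      · obtain ⟨N, hN⟩ := hSone x h
        have h1 : ∑ n ∈ Finset.range N, (S (n + 1) x - S n x) = 1 := by
          rw [Finset.sum_range_sub (fun n => S n x), hN N le_rfl, hS0, sub_zero]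
        rw [← h1]
        refine hasSum_sum_of_ne_finset_zero (fun b hb => ?_)
        have hb' : N ≤ b := by simpa using hb
        rw [hN b hb', hN (b + 1) (by omega), sub_self])
    (by
      intro x
      rcases (hg0 x).eq_or_lt with h | h
      · obtain ⟨s, -, h1, -⟩ := hPz x h.symm
        exact s.finite_toSet.subset (fun n hn => h1 n hn)
      · obtain ⟨N, hN⟩ := hSone x h
        refine (Finset.range N).finite_toSet.subset (fun n hn => ?_)
        by_contra hb
        have hb' : N ≤ n := by simpa using hb
        exact hn (by
          show S (n + 1) x - S n x = 0
          rw [hN n hb', hN (n + 1) (by omega), sub_self]))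
  refine ⟨U, G, hU, fun y hy => (hGP y (hPz y (hgY y hy))).1, hG, hGK, fun y hy => ?_⟩
  rw [(hGP y (hPz y (hgY y hy))).2, ← hΦY y hy]
  simp only [hST _ y (hgY y hy)]

/-- The inductive step. -/
theorem aux_step {X : Type*} [TopologicalSpace X] [NormalSpace X] (A : ℕ → Set X)
    (hA : ∀ i, IsClosed (A i)) (hcc : ∀ i, CountablyCompact ↥(A i)) (hcov : ⋃ i, A i = univ)
    {F : Set (Finset ℕ)} (hF : ∀ s ∈ F, ∀ t, t ⊆ s → t.Nonempty → t ∈ F)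
    (hAE : ∀ i, IsAE ↥(AuxK F) ↥(A i)) (i : ℕ)
    {Y : Set X} (hY : IsClosed Y) (f : X → ℕ → ℝ) (hf : ContinuousOn f Y)
    (hfK : ∀ y ∈ Y, f y ∈ AuxK F) :
    ∃ (C : Set X) (G : X → ℕ → ℝ), IsClosed C ∧ Y ∪ A i ⊆ interior C ∧ ContinuousOn G C ∧
      (∀ x ∈ C, G x ∈ AuxK F) ∧ EqOn G f Y := by
  classical
  obtain ⟨e, he⟩ := hAE i (Subtype.val ⁻¹' Y) (hY.preimage continuous_subtype_val)
    ⟨fun y => ⟨f y.1.1, hfK _ y.2⟩, by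
      refine Continuous.subtype_mk ?_ _
      exact hf.comp_continuous (continuous_subtype_val.comp continuous_subtype_val)
        (fun y => y.2)⟩
  let h : X → ℕ → ℝ := fun x => if hx : x ∈ A i then e ⟨x, hx⟩ else f x
  have hhf : EqOn h f Y := by
    intro y hy
    by_cases hyA : y ∈ A i
    · have := he ⟨⟨y, hyA⟩, hy⟩
      simp only [h, dif_pos hyA]
      exact congrArg Subtype.val this
    · simp only [h, dif_neg hyA]
  have hhA : ContinuousOn h (A i) := by
    rw [continuousOn_iff_continuous_domRestrict]
    have : (A i).domRestrict h = fun x => (e x : ℕ → ℝ) := by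
      funext x
      simp [h, Set.domRestrict]
    rw [this]
    exact continuous_subtype_val.comp e.continuous
  have hh : ContinuousOn h (Y ∪ A i) :=
    (hf.congr hhf).union_of_isClosed hhA hY (hA i)
  obtain ⟨U, G, hU, hYU, hG, hGK, hGh⟩ := aux_ane A hA hcc hcov hF (hY.union (hA i)) h hh (by
    rintro x (hx | hx)
    · rw [hhf hx]; exact hfK x hx
    · simp only [h, dif_pos hx]
      exact (e ⟨x, hx⟩).2)
  obtain ⟨W, hW, hYW, hWU⟩ := normal_exists_closure_subset (hY.union (hA i)) hU hYU
  exact ⟨closure W, G, isClosed_closure,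
    hYW.trans (interior_maximal subset_closure hW), hG.mono hWU, fun x hx => hGK x (hWU hx),
    fun y hy => (hGh (Or.inl hy)).trans (hhf hy)⟩

theorem aux_main {X : Type*} [TopologicalSpace X] [NormalSpace X] (A : ℕ → Set X)
    (hA : ∀ i, IsClosed (A i)) (hcc : ∀ i, CountablyCompact ↥(A i)) (hcov : ⋃ i, A i = univ)
    {F : Set (Finset ℕ)} (hF : ∀ s ∈ F, ∀ t, t ⊆ s → t.Nonempty → t ∈ F)
    (hAE : ∀ i, IsAE ↥(AuxK F) ↥(A i)) : IsAE ↥(AuxK F) X := by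
  classical
  intro Y hY f
  let St := {p : Set X × (X → ℕ → ℝ) // IsClosed p.1 ∧ ContinuousOn p.2 p.1 ∧
    ∀ x ∈ p.1, p.2 x ∈ AuxK F}
  have hstep : ∀ (i : ℕ) (p : St), ∃ p' : St, p.1.1 ∪ A i ⊆ interior p'.1.1 ∧
      EqOn p'.1.2 p.1.2 p.1.1 := by
    rintro i ⟨⟨C, h⟩, h1, h2, h3⟩
    obtain ⟨C', G, a, b, c, d, e⟩ := aux_step A hA hcc hcov hF hAE i h1 h h2 h3
    exact ⟨⟨⟨C', G⟩, a, c, d⟩, b, e⟩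
  choose nxt hn1 hn2 using hstep
  let f0 : X → ℕ → ℝ := fun x => if hx : x ∈ Y then f ⟨x, hx⟩ else 0
  have hf0 : ∀ y : Y, f0 y = f y := fun y => by simp [f0]
  let s0 : St := ⟨⟨Y, f0⟩, hY, by
    show ContinuousOn f0 Y
    rw [continuousOn_iff_continuous_domRestrict]
    have : Y.domRestrict f0 = fun x => (f x : ℕ → ℝ) := funext hf0
    rw [this]
    exact continuous_subtype_val.comp f.continuous, by
    intro x hx
    show f0 x ∈ _
    rw [hf0 ⟨x, hx⟩]
    exact (f ⟨x, hx⟩).2⟩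
  let s : ℕ → St := fun n => Nat.rec s0 (fun i p => nxt i p) n
  have hs1 : ∀ n, (s n).1.1 ∪ A n ⊆ interior (s (n + 1)).1.1 := fun n => hn1 n (s n)
  have hs2 : ∀ n, EqOn (s (n + 1)).1.2 (s n).1.2 (s n).1.1 := fun n => hn2 n (s n)
  have hmono : Monotone (fun n => (s n).1.1) := monotone_nat_of_le_succ fun n =>
    (subset_union_left.trans (hs1 n)).trans interior_subset
  have heq : ∀ n m, n ≤ m → EqOn (s m).1.2 (s n).1.2 (s n).1.1 := by
    intro n m hnm
    induction m, hnm using Nat.le_induction with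
    | base => exact fun _ _ => rfl
    | succ m hm ih => exact fun x hx => (hs2 m (hmono hm hx)).trans (ih hx)
  have hex : ∀ x, ∃ n, x ∈ interior (s n).1.1 := by
    intro x
    obtain ⟨i, hi⟩ := mem_iUnion.1 (hcov.symm.subset (mem_univ x))
    exact ⟨i + 1, hs1 i (Or.inr hi)⟩
  choose N hN using hex
  let G : X → ℕ → ℝ := fun x => (s (N x)).1.2 x
  have hG : ∀ n x, x ∈ (s n).1.1 → G x = (s n).1.2 x := by
    intro n x hx
    have h1 := heq n (max n (N x)) (le_max_left _ _) hx
    have h2 := heq (N x) (max n (N x)) (le_max_right _ _) (interior_subset (hN x))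
    exact h2.symm.trans h1
  have hGc : Continuous G := by
    rw [continuous_iff_continuousAt]
    intro x
    have hnb : (s (N x)).1.1 ∈ 𝓝 x := mem_interior_iff_mem_nhds.1 (hN x)
    refine ((s (N x)).2.2.1.continuousAt hnb).congr ?_
    filter_upwards [hnb] with y hy
    exact (hG _ y hy).symm
  refine ⟨⟨fun x => ⟨G x, (s (N x)).2.2.2 x (interior_subset (hN x))⟩, hGc.subtype_mk _⟩, ?_⟩
  intro y
  apply Subtype.ext
  exact (hG 0 y y.2).trans (hf0 y)

theorem aux_isAE_homeo {Z Z' X : Type*} [TopologicalSpace Z] [TopologicalSpace Z']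
    [TopologicalSpace X] (e : Z ≃ₜ Z') (h : IsAE Z X) : IsAE Z' X := by
  intro Y hY f
  obtain ⟨g, hg⟩ := h Y hY ((e.symm : C(Z', Z)).comp f)
  refine ⟨(e : C(Z, Z')).comp g, fun y => ?_⟩
  simp [hg y]

/-- Transport of the complex along an injection into `ℕ`. -/
def AuxF {V : Type*} (L : SimpComplex V) (e : V ↪ ℕ) : Set (Finset ℕ) :=
  {t | ∃ s ∈ L.faces, t = s.map e}

theorem AuxF.down {V : Type*} (L : SimpComplex V) (e : V ↪ ℕ) :
    ∀ s ∈ AuxF L e, ∀ t, t ⊆ s → t.Nonempty → t ∈ AuxF L e := by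
  rintro _ ⟨s, hs, rfl⟩ t ht hne
  obtain ⟨u, hu, rfl⟩ := Finset.subset_map_iff.1 ht
  exact ⟨u, L.down_closed s hs u hu (Finset.map_nonempty.1 hne), rfl⟩

theorem aux_comp {V : Type*} (L : SimpComplex V) (e : V ↪ ℕ) {p : ℕ → ℝ}
    (hp : p ∈ AuxK (AuxF L e)) : ∃ s ∈ L.faces, (∀ v, p (e v) ≠ 0 → v ∈ s) ∧
      (∀ v, 0 ≤ p (e v)) ∧ ∑ v ∈ s, p (e v) = 1 := by
  obtain ⟨_, ⟨s, hs, rfl⟩, h1, h2, h3⟩ := hp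
  refine ⟨s, hs, fun v hv => by simpa using h1 _ hv, fun v => h2 _, ?_⟩
  rwa [Finset.sum_map] at h3

theorem aux_comp_hasSum {V : Type*} (L : SimpComplex V) (e : V ↪ ℕ) {p : ℕ → ℝ}
    (hp : p ∈ AuxK (AuxF L e)) : HasSum (fun v => p (e v)) 1 := by
  obtain ⟨s, -, h1, -, h3⟩ := aux_comp L e hp
  rw [← h3]
  exact hasSum_sum_of_ne_finset_zero (fun b hb => by
    by_contra h
    exact hb (h1 b h))

theorem aux_memℓp {V : Type*} (L : SimpComplex V) (e : V ↪ ℕ) {p : ℕ → ℝ}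
    (hp : p ∈ AuxK (AuxF L e)) : Memℓp (fun v => p (e v)) 1 := by
  refine memℓp_gen ?_
  simpa using (aux_comp_hasSum L e hp).summable.abs

theorem aux_extend_mem {V : Type*} (L : SimpComplex V) (e : V ↪ ℕ)
    (f : lp (fun _ : V => ℝ) 1) (hf : f ∈ L.space) :
    Function.extend e (f : ∀ _ : V, ℝ) 0 ∈ AuxK (AuxF L e) := by
  obtain ⟨s, hs, h1, h2, h3⟩ := hf
  refine ⟨s.map e, ⟨s, hs, rfl⟩, ?_, ?_, ?_⟩
  · intro n hn
    by_cases h : ∃ v, e v = n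
    · obtain ⟨v, rfl⟩ := h
      rw [e.injective.extend_apply] at hn
      simpa using h1 v hn
    · rw [Function.extend_apply' _ _ _ h] at hn
      exact absurd rfl hn
  · intro n
    by_cases h : ∃ v, e v = n
    · obtain ⟨v, rfl⟩ := h
      rw [e.injective.extend_apply]
      exact h2 v
    · rw [Function.extend_apply' _ _ _ h]
      exact le_rfl
  · rw [Finset.sum_map]
    simpa [e.injective.extend_apply] using h3

/-- The metric realization is homeomorphic to the pointwise model. -/
noncomputable def auxHomeo {V : Type*} (L : SimpComplex V) (e : V ↪ ℕ) :
    ↥L.space ≃ₜ ↥(AuxK (AuxF L e)) where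
  toFun f := ⟨Function.extend e (f.1 : ∀ _ : V, ℝ) 0, aux_extend_mem L e f.1 f.2⟩
  invFun p := ⟨⟨fun v => p.1 (e v), aux_memℓp L e p.2⟩, aux_comp L e p.2⟩
  left_inv f := by
    apply Subtype.ext
    apply Subtype.ext
    funext v
    exact e.injective.extend_apply _ _ v
  right_inv p := by
    apply Subtype.ext
    funext n
    by_cases h : ∃ v, e v = n
    · obtain ⟨v, rfl⟩ := h
      exact e.injective.extend_apply _ _ v
    · refine (Function.extend_apply' _ _ _ h).trans ?_
      obtain ⟨_, ⟨s, hs, rfl⟩, h1, -⟩ := p.2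
      by_contra hne
      have := h1 n (fun h0 => hne h0.symm)
      obtain ⟨v, -, hv⟩ := Finset.mem_map.1 this
      exact h ⟨v, hv⟩
  continuous_toFun := by
    refine Continuous.subtype_mk (continuous_pi fun n => ?_) _
    by_cases h : ∃ v, e v = n
    · obtain ⟨v, rfl⟩ := h
      simp only [e.injective.extend_apply]
      have h1 : Continuous (fun f : lp (fun _ : V => ℝ) 1 => (f : ∀ _ : V, ℝ) v) :=
        (continuous_apply v).comp (lp.uniformContinuous_coe (E := fun _ : V => ℝ) (p := 1)).continuous
      exact h1.comp continuous_subtype_val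
    · simp only [Function.extend_apply' _ _ _ h]
      exact continuous_const
  continuous_invFun := by
    refine Continuous.subtype_mk ?_ _
    rw [continuous_iff_continuousAt]
    intro p0
    rw [ContinuousAt, tendsto_iff_dist_tendsto_zero]
    have hc : ∀ n, Continuous (fun p : ↥(AuxK (AuxF L e)) => p.1 n) := fun n =>
      (continuous_apply n).comp continuous_subtype_val
    have hnn : ∀ (p : ↥(AuxK (AuxF L e))) n, 0 ≤ p.1 n := fun p n => by
      obtain ⟨_, _, _, h, _⟩ := p.2
      exact h n
    have hS : ∀ p : ↥(AuxK (AuxF L e)), HasSum (fun v => p.1 (e v)) 1 := fun p =>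
      aux_comp_hasSum L e p.2
    have key := aux_tendsto_tsum (l := 𝓝 p0)
      (q := fun (p : ↥(AuxK (AuxF L e))) v => |p.1 (e v) - p0.1 (e v)|)
      (P := fun p v => p.1 (e v) + p0.1 (e v)) (q0 := fun _ => 0)
      (P0 := fun v => p0.1 (e v) + p0.1 (e v))
      (fun _ _ => abs_nonneg _)
      (fun p v => by rw [abs_le]; constructor <;> linarith [hnn p (e v), hnn p0 (e v)])
      (fun _ => le_rfl) (fun v => by linarith [hnn p0 (e v)])
      (fun v => by
        simpa using (((hc (e v)).sub continuous_const).abs.tendsto p0 :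
          Filter.Tendsto (fun p : ↥(AuxK (AuxF L e)) => |p.1 (e v) - p0.1 (e v)|) _ _))
      (fun v => ((hc (e v)).add continuous_const).tendsto p0)
      (fun p => (hS p).summable.add (hS p0).summable) ((hS p0).summable.add (hS p0).summable)
      (by
        have : ∀ p : ↥(AuxK (AuxF L e)), ∑' v, (p.1 (e v) + p0.1 (e v)) = 1 + 1 :=
          fun p => ((hS p).add (hS p0)).tsum_eq
        simp only [this]
        exact tendsto_const_nhds)
    rw [tsum_zero] at key
    refine key.congr fun p => ?_
    rw [dist_eq_norm, lp.norm_eq_tsum_rpow (by simp)]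
    simp
    rfl

/-- If a normal space `X` is the union of countably many closed countably compact subsets
`Xᵢ` and `L` is a countable simplicial complex with `L ∈ AE(Xᵢ)` for each `i`, then
`L ∈ AE(X)`. -/
theorem isAE_of_countable_cover_countablyCompact (X : Type u) [TopologicalSpace X]
    [NormalSpace X] (A : ℕ → Set X) (hA : ∀ i, IsClosed (A i))
    (hcc : ∀ i, CountablyCompact ↥(A i)) (hcov : ⋃ i, A i = univ)
    {V : Type v} [Countable V] (L : SimpComplex V)
    (hAE : ∀ i, IsAE ↥L.space ↥(A i)) :
    IsAE ↥L.space X := by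
  obtain ⟨e, he⟩ := exists_injective_nat V
  have H := auxHomeo L ⟨e, he⟩
  exact aux_isAE_homeo H.symm (aux_main A hA hcc hcov (AuxF.down L ⟨e, he⟩)
    (fun i => aux_isAE_homeo H (hAE i)))
end
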